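/- arXiv:2508.17277 — 2 statements merged into one kernel-verified Lean document; each statement's English description precedes it below -/
import Mathlib

section
/- There is a constant C > 0 such that for all positive integers m and k, every finite set P of points in the plane in general position with |P| ≥ C·k·m contains either a convex bundle of size k and width m or a non-crossing family of size m. -/
open scoped Classical

/-- Points in the plane. -/
abbrev Pt := ℝ × ℝ

/-- A finite planar point set is in general position if no three of its points are collinear. -/
def GenPos (P : Finset Pt) : Prop :=
  ∀ p ∈ P, ∀ q ∈ P, ∀ r ∈ P, p ≠ q → p ≠ r → q ≠ r → ¬ Collinear ℝ ({p, q, r} : Set Pt)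

/-- Two closed segments cross: their intersection is a single point lying in the
relative interior (open segment) of both. -/
def SegCross (s t : Pt × Pt) : Prop :=
  ∃ x : Pt, segment ℝ s.1 s.2 ∩ segment ℝ t.1 t.2 = {x} ∧
    x ∈ openSegment ℝ s.1 s.2 ∧ x ∈ openSegment ℝ t.1 t.2

/-- A crossing family of size `k` in `P`: `k` segments with endpoints in `P`, pairwise crossing. -/
def CrossingFamily (P : Finset Pt) (k : ℕ) : Prop :=
  ∃ F : Finset (Pt × Pt), F.card = k ∧ (∀ e ∈ F, e.1 ∈ P ∧ e.2 ∈ P) ∧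
    ∀ e ∈ F, ∀ f ∈ F, e ≠ f → SegCross e f

/-- A non-crossing family of size `m` in `P`. -/
def NonCrossingFamily (P : Finset Pt) (m : ℕ) : Prop :=
  ∃ P₁ P₂ P₃ P₄ : Finset Pt,
    P₁ ⊆ P ∧ P₂ ⊆ P ∧ P₃ ⊆ P ∧ P₄ ⊆ P ∧
    Disjoint P₁ P₂ ∧ Disjoint P₁ P₃ ∧ Disjoint P₁ P₄ ∧
    Disjoint P₂ P₃ ∧ Disjoint P₂ P₄ ∧ Disjoint P₃ P₄ ∧
    m ≤ P₁.card ∧ m ≤ P₂.card ∧ m ≤ P₃.card ∧ m ≤ P₄.card ∧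
    ∀ p₁ ∈ P₁, ∀ p₂ ∈ P₂, ∀ p₃ ∈ P₃, ∀ p₄ ∈ P₄,
      p₄ ∈ interior (convexHull ℝ ({p₁, p₂, p₃} : Set Pt))

/-- A point set is in convex position if no point lies in the convex hull of the others. -/
def ConvexPos (S : Set Pt) : Prop := ∀ p ∈ S, p ∉ convexHull ℝ (S \ {p})

/-- A convex bundle of size `k` and width `m` in `P`. -/
def ConvexBundle (P : Finset Pt) (k m : ℕ) : Prop :=
  ∃ C : Fin k → Finset Pt, (∀ i, C i ⊆ P) ∧
    (∀ i j, i ≠ j → Disjoint (C i) (C j)) ∧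
    (∀ i, m ≤ (C i).card) ∧
    ∀ f : Fin k → Pt, (∀ i, f i ∈ C i) → ConvexPos (Set.range f)

/-- Two finite point sets are separated if their convex hulls are disjoint. -/
def Separated (A B : Finset Pt) : Prop :=
  Disjoint (convexHull ℝ (A : Set Pt)) (convexHull ℝ (B : Set Pt))

/-- A line in the plane, given by an equation `a * x + b * y = c` with `(a, b) ≠ (0, 0)`. -/
structure Line where
  a : ℝ
  b : ℝ
  c : ℝ
  nondeg : a ≠ 0 ∨ b ≠ 0

/-- The set of points of a line. -/
def Line.toSet (L : Line) : Set Pt := {x | L.a * x.1 + L.b * x.2 = L.c}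

/-- Two lines are parallel if their normal vectors are proportional. -/
def Line.Parallel (L M : Line) : Prop := L.a * M.b - L.b * M.a = 0

/-- A spoke set of size `k` in `P`: `k` pairwise non-parallel lines such that every unbounded
cell of their arrangement (unbounded connected component of the complement of their union)
contains a point of `P`. -/
def SpokeSet (P : Finset Pt) (k : ℕ) : Prop :=
  ∃ ℓ : Fin k → Line,
    (∀ i j, i ≠ j → ¬ (ℓ i).Parallel (ℓ j)) ∧
    ∀ x : Pt, x ∈ (⋃ i, (ℓ i).toSet)ᶜ →
      ¬ Bornology.IsBounded (connectedComponentIn (⋃ i, (ℓ i).toSet)ᶜ x) →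
      ∃ p ∈ P, p ∈ connectedComponentIn (⋃ i, (ℓ i).toSet)ᶜ x

/-- `b` lies strictly to the left of the line through `x` and `y`, oriented from `x` to `y`. -/
def LeftOf (x y b : Pt) : Prop :=
  0 < (y.1 - x.1) * (b.2 - x.2) - (y.2 - x.2) * (b.1 - x.1)

/-- The relation `<_B`: `x <_B y` iff `B` is contained in the open half-plane to the left of
the line through `x` and `y` oriented from `x` towards `y`. -/
def LtRel (B : Finset Pt) (x y : Pt) : Prop :=
  x ≠ y ∧ ∀ b ∈ B, LeftOf x y b

/-- `x` and `y` are incomparable in `<_B`. -/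
def Incomp (B : Finset Pt) (x y : Pt) : Prop := ¬ LtRel B x y ∧ ¬ LtRel B y x

/-- `ι(A, <_B)`: the number of unordered pairs of distinct points of `A`
that are incomparable in `<_B`. -/
noncomputable def iota (A B : Finset Pt) : ℕ :=
  Set.ncard {s : Finset Pt | ∃ x y : Pt, x ≠ y ∧ s = {x, y} ∧ x ∈ A ∧ y ∈ A ∧ Incomp B x y}

/-- `A` and `B` (two `m`-element sets) form an `ε`-avoiding pair. -/
def EpsAvoiding (ε : ℝ) (m : ℕ) (A B : Finset Pt) : Prop :=
  ((iota A B : ℝ) + (iota B A : ℝ)) ≤ ε * (m : ℝ) ^ 2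

/-- The zone of a line `ℓ` in the arrangement of the lines `ℓs`: the union of all cells
(connected components of the complement) whose closure meets `ℓ`. -/
noncomputable def Zone (r : ℕ) (ℓs : Fin r → Line) (ℓ : Line) : Set Pt :=
  {y | ∃ x ∈ (⋃ i, (ℓs i).toSet)ᶜ,
    y ∈ connectedComponentIn (⋃ i, (ℓs i).toSet)ᶜ x ∧
    (closure (connectedComponentIn (⋃ i, (ℓs i).toSet)ᶜ x) ∩ ℓ.toSet).Nonempty}

open Finset in
lemma exists_rank {α : Type*} (Q : Finset α) (f : α → ℝ) :
    ∃ ρ : α → ℕ, Set.InjOn ρ Q ∧ Q.image ρ = Finset.range Q.card ∧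
      ∀ p ∈ Q, ∀ q ∈ Q, ρ p ≤ ρ q → f p ≤ f q := by
  induction Q using Finset.induction_on_max_value f with
  | empty => exact ⟨fun _ => 0, by simp, by simp, by simp⟩
  | insert a s ha hmax ih =>
    obtain ⟨ρ, h1, h2, h3⟩ := ih
    have hlt : ∀ x ∈ s, ρ x < s.card := by
      intro x hx
      have : ρ x ∈ s.image ρ := mem_image_of_mem _ hx
      rw [h2] at this
      simpa using this
    have hne : ∀ x ∈ s, x ≠ a := fun x hx h => ha (h ▸ hx)
    have hu : ∀ x ∈ s, Function.update ρ a s.card x = ρ x := by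
      intro x hx
      simp [Function.update, hne x hx]
    have hua : Function.update ρ a s.card a = s.card := by simp
    refine ⟨Function.update ρ a s.card, ?_, ?_, ?_⟩
    · intro x hx y hy hxy
      simp only [coe_insert, Set.mem_insert_iff, mem_coe] at hx hy
      rcases hx with rfl | hx <;> rcases hy with rfl | hy
      · rfl
      · rw [hua, hu y hy] at hxy
        have := hlt y hy
        omega
      · rw [hua, hu x hx] at hxy
        have := hlt x hx
        omega
      · rw [hu x hx, hu y hy] at hxy
        exact h1 hx hy hxy
    · rw [image_insert, hua, card_insert_of_notMem ha, range_add_one, ← h2]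
      congr 1
      exact image_congr (fun x hx => hu x hx)
    · intro p hp q hq hpq
      rw [mem_insert] at hp hq
      rcases hp with rfl | hp <;> rcases hq with rfl | hq
      · exact le_rfl
      · rw [hua, hu q hq] at hpq
        have := hlt q hq
        omega
      · exact hmax p hp
      · rw [hu p hp, hu q hq] at hpq
        exact h3 p hp q hq hpq

lemma card_between {α : Type*} (Q : Finset α) (ρ : α → ℕ) (hinj : Set.InjOn ρ Q)
    (him : Q.image ρ = Finset.range Q.card) (a b : ℕ) (hb : b ≤ Q.card) :
    (Q.filter (fun s => a ≤ ρ s ∧ ρ s < b)).card = b - a := by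
  rw [← Nat.card_Ico a b, ← Finset.card_image_of_injOn (f := ρ)]
  · congr 1
    ext i
    simp only [Finset.mem_image, Finset.mem_filter, Finset.mem_Ico]
    constructor
    · rintro ⟨s, ⟨_, h⟩, rfl⟩
      exact h
    · intro hi
      have : i ∈ Q.image ρ := by
        rw [him]
        simp
        omega
      obtain ⟨s, hs, rfl⟩ := Finset.mem_image.1 this
      exact ⟨s, ⟨hs, hi⟩, rfl⟩
  · exact hinj.mono (by intro x hx; exact (Finset.mem_filter.1 hx).1)

/-- The value of a linear functional. -/
def vl (e s : ℝ) (p : Pt) : ℝ := e * p.2 - s * p.1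

/-- If `s` is between `a` and `b` then a strict inequality at slope `s` is witnessed
at slope `a` or `b`. -/
lemma vl_between (e a b s : ℝ) (h1 : a ≤ s) (h2 : s ≤ b) (p q : Pt)
    (h : vl e s q < vl e s p) : vl e a q < vl e a p ∨ vl e b q < vl e b p := by
  by_contra! hc
  obtain ⟨ha, hb⟩ := hc
  unfold vl at *
  rcases le_total p.1 q.1 with hx | hx
  · nlinarith [mul_le_mul_of_nonneg_right h1 (sub_nonneg.2 hx),
      mul_le_mul_of_nonneg_right h2 (sub_nonneg.2 hx)]
  · nlinarith [mul_le_mul_of_nonneg_right h1 (sub_nonneg.2 hx),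
      mul_le_mul_of_nonneg_right h2 (sub_nonneg.2 hx)]

lemma not_mem_hull_of_vl (e s : ℝ) (p : Pt) (T : Set Pt) (h : ∀ q ∈ T, vl e s q < vl e s p) :
    p ∉ convexHull ℝ T := by
  intro hp
  have hconv : Convex ℝ {q : Pt | vl e s q < vl e s p} := by
    intro x hx y hy a b ha hb hab
    simp only [Set.mem_ofPred_eq, vl, Prod.fst_add, Prod.snd_add, Prod.smul_fst, Prod.smul_snd,
      smul_eq_mul] at *
    rcases ha.eq_or_lt with h0 | h0
    · have : b = 1 := by linarith
      subst h0 this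
      linarith
    · have e1 : a * (e * x.2 - s * x.1) < a * (e * p.2 - s * p.1) :=
        mul_lt_mul_of_pos_left hx h0
      have e2 : b * (e * y.2 - s * y.1) ≤ b * (e * p.2 - s * p.1) :=
        mul_le_mul_of_nonneg_left hy.le hb
      have : b = 1 - a := by linarith
      subst this
      nlinarith
  have : p ∈ {q : Pt | vl e s q < vl e s p} := convexHull_min h hconv hp
  simp only [Set.mem_ofPred_eq] at this
  exact lt_irrefl _ this

open Finset in
lemma shallow_case (P S : Finset Pt) (hSP : S ⊆ P) (e : ℝ) (h k m : ℕ)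
    (hS : ∀ p ∈ S, ∃ s, (S.filter (fun q => vl e s p ≤ vl e s q)).card ≤ h)
    (hc : 2 * (k * (m + 4 * h)) ≤ S.card) : ConvexBundle P k m := by
  have hS' : ∀ p : Pt, ∃ s, p ∈ S → (S.filter (fun q => vl e s p ≤ vl e s q)).card ≤ h := by
    intro p
    by_cases hp : p ∈ S
    · obtain ⟨s, hs⟩ := hS p hp
      exact ⟨s, fun _ => hs⟩
    · exact ⟨0, fun h => absurd h hp⟩
  choose σ hσ using hS'
  set Q := S.filter (fun q => (S.filter (fun p => vl e (σ p) p ≤ vl e (σ p) q)).card ≤ 2 * h)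
    with hQ
  have hQS : Q ⊆ S := filter_subset _ _
  have hQc : S.card ≤ 2 * Q.card := by
    have hsum : ∑ q ∈ S, (S.filter (fun p => vl e (σ p) p ≤ vl e (σ p) q)).card ≤ S.card * h := by
      have := sum_card_bipartiteAbove_eq_sum_card_bipartiteBelow (s := S) (t := S)
        (fun p q : Pt => vl e (σ p) p ≤ vl e (σ p) q)
      unfold bipartiteAbove bipartiteBelow at this
      rw [← this]
      calc _ ≤ ∑ p ∈ S, h := sum_le_sum (fun p hp => hσ p hp)
        _ = _ := by simp
    have hlow : (S.filter (fun q => ¬ (S.filter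
        (fun p => vl e (σ p) p ≤ vl e (σ p) q)).card ≤ 2 * h)).card * (2 * h + 1) ≤ S.card * h := by
      refine le_trans ?_ hsum
      refine le_trans ?_ (sum_le_sum_of_subset (filter_subset (fun q => ¬ (S.filter
        (fun p => vl e (σ p) p ≤ vl e (σ p) q)).card ≤ 2 * h) S))
      rw [← smul_eq_mul, ← sum_const]
      apply sum_le_sum
      intro q hq
      have := (mem_filter.1 hq).2
      omega
    have hsplit := card_filter_add_card_filter_not (s := S)
      (fun q => (S.filter (fun p => vl e (σ p) p ≤ vl e (σ p) q)).card ≤ 2 * h)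
    rw [← hQ] at hsplit
    by_contra! hcon
    set B := (S.filter (fun q => ¬ (S.filter
        (fun p => vl e (σ p) p ≤ vl e (σ p) q)).card ≤ 2 * h)).card
    have : S.card < 2 * B := by omega
    nlinarith
  obtain ⟨ρ, hinj, him, hmono⟩ := exists_rank Q σ
  have hcard : k * (m + 4 * h) ≤ Q.card := by omega
  have hlt : ∀ x ∈ Q, ρ x < Q.card := by
    intro x hx
    have : ρ x ∈ Q.image ρ := mem_image_of_mem _ hx
    rw [him] at this
    simpa using this
  -- key locality
  have hkey : ∀ p ∈ Q, ∀ q ∈ Q, vl e (σ p) p ≤ vl e (σ p) q →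
      ρ p < ρ q + 4 * h ∧ ρ q < ρ p + 4 * h := by
    intro p hp q hq hpq
    have hcov : ∀ s ∈ Q, (σ p ≤ σ s ∧ σ s ≤ σ q) ∨ (σ q ≤ σ s ∧ σ s ≤ σ p) →
        s ∈ S.filter (fun s => vl e (σ s) s ≤ vl e (σ s) q) ∪
          (S.filter (fun s => vl e (σ p) p ≤ vl e (σ p) s) ∪
           S.filter (fun s => vl e (σ q) q ≤ vl e (σ q) s)) := by
      intro s hs hb
      simp only [mem_union, mem_filter, hQS hs, true_and]
      by_contra! hcon
      obtain ⟨c1, c2, c3⟩ := hcon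
      rcases hb with hb | hb
      · rcases vl_between e _ _ _ hb.1 hb.2 s q c1 with h | h <;> linarith
      · rcases vl_between e _ _ _ hb.1 hb.2 s q c1 with h | h <;> linarith
    have hcc : (S.filter (fun s => vl e (σ s) s ≤ vl e (σ s) q) ∪
          (S.filter (fun s => vl e (σ p) p ≤ vl e (σ p) s) ∪
           S.filter (fun s => vl e (σ q) q ≤ vl e (σ q) s))).card ≤ 4 * h := by
      have h1 := card_union_le (S.filter (fun s => vl e (σ s) s ≤ vl e (σ s) q))
          (S.filter (fun s => vl e (σ p) p ≤ vl e (σ p) s) ∪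
           S.filter (fun s => vl e (σ q) q ≤ vl e (σ q) s))
      have h2 := card_union_le (S.filter (fun s => vl e (σ p) p ≤ vl e (σ p) s))
           (S.filter (fun s => vl e (σ q) q ≤ vl e (σ q) s))
      have h3 := hσ p (hQS hp)
      have h4 := hσ q (hQS hq)
      have h5 := (mem_filter.1 hq).2
      omega
    have hlp := hlt p hp
    have hlq := hlt q hq
    have g1 := card_between Q ρ hinj him (ρ p) (ρ q + 1) (by omega)
    have g2 := card_between Q ρ hinj him (ρ q) (ρ p + 1) (by omega)
    have k1 := card_le_card (s := Q.filter (fun s => ρ p ≤ ρ s ∧ ρ s < ρ q + 1)) (by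
      intro s hs
      obtain ⟨hs, h1, h2⟩ := mem_filter.1 hs
      exact hcov s hs (Or.inl ⟨hmono _ hp _ hs h1, hmono _ hs _ hq (by omega)⟩))
    have k2 := card_le_card (s := Q.filter (fun s => ρ q ≤ ρ s ∧ ρ s < ρ p + 1)) (by
      intro s hs
      obtain ⟨hs, h1, h2⟩ := mem_filter.1 hs
      exact hcov s hs (Or.inr ⟨hmono _ hq _ hs h1, hmono _ hs _ hp (by omega)⟩))
    omega
  set w := m + 4 * h with hw
  have hsep : ∀ i j : Fin k, i ≠ j → ∀ p q, (i.1 * w ≤ ρ p ∧ ρ p < i.1 * w + m) →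
      (j.1 * w ≤ ρ q ∧ ρ q < j.1 * w + m) →
      ρ p + 4 * h < ρ q ∨ ρ q + 4 * h < ρ p := by
    intro i j hij p q hp hq
    have : i.1 ≠ j.1 := fun h => hij (Fin.ext h)
    rcases lt_or_gt_of_ne this with hl | hl
    · left
      have : (i.1 + 1) * w ≤ j.1 * w := Nat.mul_le_mul_right _ hl
      rw [add_mul] at this
      omega
    · right
      have : (j.1 + 1) * w ≤ i.1 * w := Nat.mul_le_mul_right _ hl
      rw [add_mul] at this
      omega
  refine ⟨fun i => Q.filter (fun s => i.1 * w ≤ ρ s ∧ ρ s < i.1 * w + m), ?_, ?_, ?_, ?_⟩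
  · intro i
    exact (filter_subset _ _).trans (hQS.trans hSP)
  · intro i j hij
    rw [disjoint_left]
    intro x hx hy
    have := hsep i j hij x x (mem_filter.1 hx).2 (mem_filter.1 hy).2
    omega
  · intro i
    rw [card_between Q ρ hinj him]
    · omega
    · have : (i.1 + 1) * w ≤ k * w := Nat.mul_le_mul_right _ i.2
      rw [add_mul] at this
      omega
  · intro f hf
    rintro _ ⟨i, rfl⟩
    apply not_mem_hull_of_vl e (σ (f i))
    rintro _ ⟨⟨j, rfl⟩, hne⟩
    have hij : i ≠ j := by
      rintro rfl
      exact hne rfl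
    by_contra! hcon
    have h1 := mem_filter.1 (hf i)
    have h2 := mem_filter.1 (hf j)
    have := hkey _ h1.1 _ h2.1 hcon
    have := hsep i j hij _ _ h1.2 h2.2
    omega

/-- Orientation determinant. -/
def ori (a b z : Pt) : ℝ := (b.1 - a.1) * (z.2 - a.2) - (b.2 - a.2) * (z.1 - a.1)

lemma tri_interior (a b c z : Pt) (h1 : 0 < ori a b z) (h2 : 0 < ori b c z)
    (h3 : 0 < ori c a z) : z ∈ interior (convexHull ℝ ({a, b, c} : Set Pt)) := by
  rw [mem_interior]
  refine ⟨{z | 0 < ori a b z} ∩ {z | 0 < ori b c z} ∩ {z | 0 < ori c a z}, ?_, ?_,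
    ⟨⟨h1, h2⟩, h3⟩⟩
  · rintro z ⟨⟨h1, h2⟩, h3⟩
    simp only [Set.mem_ofPred_eq] at h1 h2 h3
    have hD : 0 < ori a b z + ori b c z + ori c a z := by linarith
    have := (convex_convexHull ℝ ({a, b, c} : Set Pt)).sum_mem (t := Finset.univ)
      (w := ![ori b c z / (ori a b z + ori b c z + ori c a z),
        ori c a z / (ori a b z + ori b c z + ori c a z),
        ori a b z / (ori a b z + ori b c z + ori c a z)]) (z := ![a, b, c])
      (by intro i _; fin_cases i <;> simp <;> positivity)
      (by simp [Fin.sum_univ_three]; field_simp; ring)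
      (by intro i _; apply subset_convexHull; fin_cases i <;> simp)
    convert this using 1
    simp only [Fin.sum_univ_three]
    ext
    · simp
      field_simp
      unfold ori
      ring
    · simp
      field_simp
      unfold ori
      ring
  · refine IsOpen.inter (IsOpen.inter ?_ ?_) ?_ <;>
    · apply isOpen_lt continuous_const
      unfold ori
      fun_prop

lemma tri_in1 (l r₁ r₂ p : Pt) (hl : l.1 < p.1) (h1 : p.1 < r₁.1) (h2 : p.1 < r₂.1)
    (o1 : 0 < ori l r₁ p) (o2 : ori l r₂ p < 0) :
    p ∈ interior (convexHull ℝ ({l, r₁, r₂} : Set Pt)) := by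
  apply tri_interior _ _ _ _ o1
  · have : 0 < (p.1 - l.1) * ori r₁ r₂ p := by
      have e : (p.1 - l.1) * ori r₁ r₂ p =
        (r₁.1 - p.1) * (- ori l r₂ p) + (r₂.1 - p.1) * ori l r₁ p := by
        unfold ori; ring
      rw [e]
      have := mul_pos (sub_pos.2 h1) (neg_pos.2 o2)
      have := mul_pos (sub_pos.2 h2) o1
      linarith
    exact pos_of_mul_pos_right this (sub_pos.2 hl).le
  · have : ori r₂ l p = - ori l r₂ p := by unfold ori; ring
    linarith

lemma tri_in2 (l₁ l₂ r p : Pt) (h1 : l₁.1 < p.1) (h2 : l₂.1 < p.1) (hr : p.1 < r.1)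
    (o1 : ori l₁ r p < 0) (o2 : 0 < ori l₂ r p) :
    p ∈ interior (convexHull ℝ ({l₁, l₂, r} : Set Pt)) := by
  refine tri_interior _ _ _ _ ?_ o2 ?_
  · have : 0 < (r.1 - p.1) * ori l₁ l₂ p := by
      have e : (r.1 - p.1) * ori l₁ l₂ p =
        (p.1 - l₁.1) * (ori l₂ r p) + (p.1 - l₂.1) * (- ori l₁ r p) := by
        unfold ori; ring
      rw [e]
      have := mul_pos (sub_pos.2 h2) (neg_pos.2 o1)
      have := mul_pos (sub_pos.2 h1) o2
      linarith
    exact pos_of_mul_pos_right this (sub_pos.2 hr).le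
  · have : ori r l₁ p = - ori l₁ r p := by unfold ori; ring
    linarith

lemma collinear_of_vl (e s : ℝ) (he : e ≠ 0) (p q r : Pt) (h1 : vl e s p = vl e s q)
    (h2 : vl e s p = vl e s r) : Collinear ℝ ({p, q, r} : Set Pt) := by
  rw [collinear_iff_of_mem (p₀ := p) (by simp)]
  refine ⟨(e, s), ?_⟩
  have key : ∀ z : Pt, vl e s p = vl e s z → ∃ t : ℝ, z = t • ((e, s) : Pt) +ᵥ p := by
    intro z hz
    unfold vl at hz
    refine ⟨(z.1 - p.1) / e, ?_⟩
    ext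
    · simp
      field_simp
      ring
    · simp
      field_simp
      linarith
  rintro z (rfl | rfl | rfl)
  · exact key _ rfl
  · exact key _ h1
  · exact key _ h2

lemma chord (e s c : ℝ) (he : e ≠ 0) (P : Finset Pt) (hP : GenPos P) (l r p : Pt)
    (hl : l ∈ P) (hr : r ∈ P) (hp : p ∈ P) (h1 : l.1 < p.1) (h2 : p.1 < r.1)
    (vp : vl e s p ≤ c) (vL : c ≤ vl e s l) (vr : c ≤ vl e s r) : e * ori l r p < 0 := by
  have hid : e * ori l r p = (r.1 - p.1) * (vl e s p - vl e s l)
      + (p.1 - l.1) * (vl e s p - vl e s r) := by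
    unfold ori vl; ring
  have hnot : ¬ (vl e s p = vl e s l ∧ vl e s p = vl e s r) := by
    rintro ⟨a, b⟩
    refine hP p hp l hl r hr ?_ ?_ ?_ (collinear_of_vl e s he p l r a b)
    · rintro rfl; exact lt_irrefl _ h1
    · rintro rfl; exact lt_irrefl _ h2
    · rintro rfl; exact lt_irrefl _ (h1.trans h2)
  rw [hid]
  rcases (vp.trans vL).eq_or_lt with ha | ha
  · rcases (vp.trans vr).eq_or_lt with hb | hb
    · exact absurd ⟨ha, hb⟩ hnot
    · have := mul_pos (sub_pos.2 h1) (sub_pos.2 hb)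
      rw [ha] at *
      nlinarith
  · have := mul_pos (sub_pos.2 h2) (sub_pos.2 ha)
    have := mul_nonneg (sub_pos.2 h1).le (sub_nonneg.2 (vp.trans vr))
    nlinarith

open Finset in
lemma ostat (e : ℝ) (S : Finset Pt) (a : ℕ) (ha : 1 ≤ a) (haS : a ≤ S.card) :
    ∃ f : ℝ → ℝ, Continuous f ∧ ∀ s, a ≤ (S.filter (fun x => f s ≤ vl e s x)).card ∧
      (S.filter (fun x => f s < vl e s x)).card < a := by
  have hne : (S.powersetCard a).Nonempty := powersetCard_nonempty.2 haS
  refine ⟨fun s => (S.powersetCard a).sup' hne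
    (fun T => if h : T.Nonempty then T.inf' h (fun x => vl e s x) else 0), ?_, ?_⟩
  · apply Continuous.finset_sup'_apply
    intro T _
    by_cases h : T.Nonempty
    · simp only [h, dif_pos]
      apply Continuous.finset_inf'_apply
      intro x _
      unfold vl
      fun_prop
    · simp only [h]
      exact continuous_const
  · intro s
    constructor
    · obtain ⟨T, hT, hTe⟩ := exists_mem_eq_sup' hne
        (fun T : Finset Pt => if h : T.Nonempty then T.inf' h (fun x => vl e s x) else 0)
      beta_reduce
      rw [hTe]
      obtain ⟨hTS, hTc⟩ := mem_powersetCard.1 hT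
      have hTn : T.Nonempty := card_pos.1 (by omega)
      rw [← hTc]
      apply card_le_card
      intro x hx
      rw [mem_filter]
      refine ⟨hTS hx, ?_⟩
      rw [dif_pos hTn]
      exact inf'_le _ hx
    · by_contra! hcon
      obtain ⟨T, hT, hTc⟩ := exists_subset_card_eq hcon
      have hTn : T.Nonempty := card_pos.1 (by omega)
      have hTm : T ∈ S.powersetCard a :=
        mem_powersetCard.2 ⟨hT.trans (filter_subset _ _), hTc⟩
      have h1 := le_sup' (fun T : Finset Pt =>
        if h : T.Nonempty then T.inf' h (fun x => vl e s x) else 0) hTm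
      simp only [dif_pos hTn] at h1
      have h2 := (lt_inf'_iff hTn (f := fun x => vl e s x)).2
        (fun x hx => (mem_filter.1 (hT hx)).2)
      exact absurd h1 (not_le.2 h2)

open Filter in
lemma sep_top (e : ℝ) (X Y : Finset Pt) (hXY : ∀ x ∈ X, ∀ y ∈ Y, x.1 < y.1) :
    ∃ s, ∀ x ∈ X, ∀ y ∈ Y, vl e s y < vl e s x := by
  have : ∀ᶠ s : ℝ in atTop, ∀ x ∈ X, ∀ y ∈ Y, vl e s y < vl e s x := by
    rw [Filter.eventually_all_finset]
    intro x hx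
    rw [Filter.eventually_all_finset]
    intro y hy
    have h := sub_pos.2 (hXY x hx y hy)
    filter_upwards [eventually_gt_atTop ((e * y.2 - e * x.2) / (y.1 - x.1))] with s hs
    rw [div_lt_iff₀ h] at hs
    unfold vl
    linarith
  exact this.exists

open Filter in
lemma sep_bot (e : ℝ) (X Y : Finset Pt) (hXY : ∀ x ∈ X, ∀ y ∈ Y, x.1 < y.1) :
    ∃ s, ∀ x ∈ X, ∀ y ∈ Y, vl e s x < vl e s y := by
  obtain ⟨s, hs⟩ := sep_top (-e) X Y hXY
  refine ⟨-s, fun x hx y hy => ?_⟩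
  have := hs x hx y hy
  unfold vl at *
  linarith

open Finset in
lemma ham (e : ℝ) (X Y : Finset Pt) (hXY : ∀ x ∈ X, ∀ y ∈ Y, x.1 < y.1) (a b : ℕ)
    (ha : 1 ≤ a) (haX : a ≤ X.card) (hb : 1 ≤ b) (hbY : b ≤ Y.card) :
    ∃ s c : ℝ, a ≤ (X.filter (fun x => c ≤ vl e s x)).card ∧
      (X.filter (fun x => c < vl e s x)).card < a ∧
      b ≤ (Y.filter (fun x => c ≤ vl e s x)).card ∧
      (Y.filter (fun x => c < vl e s x)).card < b := by
  obtain ⟨f, hf, hf'⟩ := ostat e X a ha haX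
  obtain ⟨g, hg, hg'⟩ := ostat e Y b hb hbY
  have aux : ∀ (S : Finset Pt) (n : ℕ) (c s : ℝ), 1 ≤ n → n ≤ S.card →
      n ≤ (S.filter (fun x => c ≤ vl e s x)).card →
      (S.filter (fun x => c < vl e s x)).card < n →
      (∃ x ∈ S, c ≤ vl e s x) ∧ ∃ x ∈ S, vl e s x ≤ c := by
    intro S n c s h1 h2 h3 h4
    constructor
    · obtain ⟨x, hx⟩ := card_pos.1 (show 0 < (S.filter (fun x => c ≤ vl e s x)).card by omega)
      exact ⟨x, (mem_filter.1 hx).1, (mem_filter.1 hx).2⟩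
    · by_contra! hcon
      rw [filter_true_of_mem hcon] at h4
      omega
  obtain ⟨s₁, hs₁⟩ := sep_bot e X Y hXY
  obtain ⟨s₂, hs₂⟩ := sep_top e X Y hXY
  have l1 : f s₁ ≤ g s₁ := by
    obtain ⟨⟨x, hx, hx'⟩, -⟩ := aux X a _ s₁ ha haX (hf' s₁).1 (hf' s₁).2
    obtain ⟨-, ⟨y, hy, hy'⟩⟩ := aux Y b _ s₁ hb hbY (hg' s₁).1 (hg' s₁).2
    linarith [hs₁ x hx y hy]
  have l2 : g s₂ ≤ f s₂ := by
    obtain ⟨-, ⟨x, hx, hx'⟩⟩ := aux X a _ s₂ ha haX (hf' s₂).1 (hf' s₂).2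
    obtain ⟨⟨y, hy, hy'⟩, -⟩ := aux Y b _ s₂ hb hbY (hg' s₂).1 (hg' s₂).2
    linarith [hs₂ x hx y hy]
  obtain ⟨s, hs⟩ := intermediate_value_univ₂ hf hg l1 l2
  refine ⟨s, f s, (hf' s).1, (hf' s).2, ?_, ?_⟩
  · rw [hs]; exact (hg' s).1
  · rw [hs]; exact (hg' s).2

open Finset in
lemma upper (e : ℝ) (he : e ≠ 0) (P : Finset Pt) (hP : GenPos P) (m : ℕ) (hm : 0 < m)
    (L M R Y : Finset Pt) (hLP : L ⊆ P) (hRP : R ⊆ P) (hYP : Y ⊆ P)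
    (hcov : P ⊆ L ∪ M ∪ R) (hM : M.card ≤ 8 * m + 1)
    (hLY : ∀ l ∈ L, ∀ y ∈ Y, l.1 < y.1) (hYR : ∀ y ∈ Y, ∀ r ∈ R, y.1 < r.1)
    (hY : Y.Nonempty)
    (hdeep : ∀ p ∈ Y, ∀ s, 12 * m < (P.filter (fun q => vl e s p ≤ vl e s q)).card) :
    ∃ Lu Ru : Finset Pt, Lu ⊆ L ∧ Ru ⊆ R ∧ 2 * m ≤ Lu.card ∧ 2 * m ≤ Ru.card ∧
      ∀ l ∈ Lu, ∀ r ∈ Ru, ∀ p ∈ Y, e * ori l r p < 0 := by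
  have hLc : 2 * m ≤ L.card := by
    obtain ⟨p, hp⟩ := hY
    obtain ⟨s, hs⟩ := sep_top e Y R hYR
    have h1 := hdeep p hp s
    have h2 : P.filter (fun q => vl e s p ≤ vl e s q) ⊆ L ∪ M := by
      intro q hq
      obtain ⟨hq, hv⟩ := mem_filter.1 hq
      have := hcov hq
      rw [mem_union] at this
      rcases this with h | h
      · exact h
      · have := hs p hp q h
        linarith
    have h3 := card_le_card h2
    have h4 := card_union_le L M
    omega
  obtain ⟨s, c, h1, h2, h3, h4⟩ := ham e L Y hLY (2 * m) 1 (by omega) hLc le_rfl (card_pos.2 hY)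
  have hYc : ∀ y ∈ Y, vl e s y ≤ c := by
    intro y hy
    by_contra! hcon
    have : 0 < (Y.filter (fun x => c < vl e s x)).card :=
      card_pos.2 ⟨y, mem_filter.2 ⟨hy, hcon⟩⟩
    omega
  obtain ⟨p, hp⟩ := card_pos.1 (show 0 < (Y.filter (fun x => c ≤ vl e s x)).card by omega)
  obtain ⟨hp, hpc⟩ := mem_filter.1 hp
  have hpc : vl e s p = c := le_antisymm (hYc p hp) hpc
  refine ⟨L.filter (fun x => c ≤ vl e s x), R.filter (fun x => c ≤ vl e s x),
    filter_subset _ _, filter_subset _ _, h1, ?_, ?_⟩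
  · have hone : (L.filter (fun x => vl e s x = c)).card ≤ 1 := by
      rw [card_le_one]
      intro a ha b hb
      obtain ⟨ha, ha'⟩ := mem_filter.1 ha
      obtain ⟨hb, hb'⟩ := mem_filter.1 hb
      by_contra hab
      refine hP p (hYP hp) a (hLP ha) b (hLP hb) ?_ ?_ hab
        (collinear_of_vl e s he p a b (by linarith) (by linarith))
      · rintro rfl; exact lt_irrefl _ (hLY _ ha _ hp)
      · rintro rfl; exact lt_irrefl _ (hLY _ hb _ hp)
    have hsub : P.filter (fun q => vl e s p ≤ vl e s q) ⊆
        (M ∪ L.filter (fun x => c < vl e s x)) ∪ (L.filter (fun x => vl e s x = c) ∪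
          R.filter (fun x => c ≤ vl e s x)) := by
      intro q hq
      obtain ⟨hq, hv⟩ := mem_filter.1 hq
      have := hcov hq
      simp only [mem_union, mem_filter] at this ⊢
      rw [hpc] at hv
      rcases hv.eq_or_lt with h | h
      · have := h.symm
        tauto
      · tauto
    have k1 := card_le_card hsub
    have k2 := card_union_le (M ∪ L.filter (fun x => c < vl e s x))
      (L.filter (fun x => vl e s x = c) ∪ R.filter (fun x => c ≤ vl e s x))
    have k3 := card_union_le M (L.filter (fun x => c < vl e s x))
    have k4 := card_union_le (L.filter (fun x => vl e s x = c)) (R.filter (fun x => c ≤ vl e s x))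
    have k5 := hdeep p hp s
    omega
  · intro l hl r hr y hy
    obtain ⟨hl, hl'⟩ := mem_filter.1 hl
    obtain ⟨hr, hr'⟩ := mem_filter.1 hr
    exact chord e s c he P hP l r y (hLP hl) (hRP hr) (hYP hy) (hLY l hl y hy) (hYR y hy r hr)
      (hYc y hy) hl' hr'

open Finset in
lemma split3 (P : Finset Pt) (hP : GenPos P) (m : ℕ) (hm : 0 < m)
    (X Y Z : Finset Pt) (hXP : X ⊆ P) (hYP : Y ⊆ P) (hZP : Z ⊆ P)
    (hXY : ∀ x ∈ X, ∀ y ∈ Y, x.1 < y.1) (hYZ : ∀ y ∈ Y, ∀ z ∈ Z, y.1 < z.1)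
    (hX : 2 * m ≤ X.card) (hY : 2 * m ≤ Y.card) (hZ : 2 * m ≤ Z.card) :
    ∃ X' Y' Z' : Finset Pt, X' ⊆ X ∧ Y' ⊆ Y ∧ Z' ⊆ Z ∧ m ≤ X'.card ∧ m ≤ Y'.card ∧ m ≤ Z'.card ∧
      ((∀ x ∈ X', ∀ z ∈ Z', ∀ y ∈ Y', ori x z y < 0) ∨
       (∀ x ∈ X', ∀ z ∈ Z', ∀ y ∈ Y', 0 < ori x z y)) := by
  obtain ⟨s, c, h1, h2, h3, h4⟩ := ham 1 X Y hXY m m hm (by omega) hm (by omega)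
  have low : ∀ S : Finset Pt, (S.filter (fun x => c < vl 1 s x)).card +
      (S.filter (fun x => vl 1 s x ≤ c)).card = S.card := by
    intro S
    have := card_filter_add_card_filter_not (s := S) (fun x => c < vl 1 s x)
    simpa only [not_lt] using this
  have lX := low X
  have lY := low Y
  have lZ := low Z
  have hle : (Z.filter (fun x => c < vl 1 s x)).card ≤ (Z.filter (fun x => c ≤ vl 1 s x)).card := by
    apply card_le_card
    intro x hx
    rw [mem_filter] at *
    exact ⟨hx.1, hx.2.le⟩
  by_cases hz : m ≤ (Z.filter (fun x => c ≤ vl 1 s x)).card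
  · refine ⟨X.filter (fun x => c ≤ vl 1 s x), Y.filter (fun x => vl 1 s x ≤ c),
      Z.filter (fun x => c ≤ vl 1 s x), filter_subset _ _, filter_subset _ _, filter_subset _ _,
      h1, by omega, hz, Or.inl ?_⟩
    intro x hx z hz y hy
    rw [mem_filter] at hx hy hz
    have := chord 1 s c one_ne_zero P hP x z y (hXP hx.1) (hZP hz.1) (hYP hy.1)
      (hXY _ hx.1 _ hy.1) (hYZ _ hy.1 _ hz.1) hy.2 hx.2 hz.2
    linarith
  · refine ⟨X.filter (fun x => vl 1 s x ≤ c), Y.filter (fun x => c ≤ vl 1 s x),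
      Z.filter (fun x => vl 1 s x ≤ c), filter_subset _ _, filter_subset _ _, filter_subset _ _,
      by omega, h3, by omega, Or.inr ?_⟩
    intro x hx z hz y hy
    rw [mem_filter] at hx hy hz
    have hneg : ∀ q, vl (-1) (-s) q = - vl 1 s q := by intro q; unfold vl; ring
    have := chord (-1) (-s) (-c) (by norm_num) P hP x z y (hXP hx.1) (hZP hz.1) (hYP hy.1)
      (hXY _ hx.1 _ hy.1) (hYZ _ hy.1 _ hz.1) (by rw [hneg]; linarith [hy.2])
      (by rw [hneg]; linarith [hx.2]) (by rw [hneg]; linarith [hz.2])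
    linarith

lemma disj_of_lt (A B : Finset Pt) (h : ∀ a ∈ A, ∀ b ∈ B, a.1 < b.1) : Disjoint A B := by
  rw [Finset.disjoint_left]
  intro x hx hy
  exact lt_irrefl _ (h x hx x hy)

open Finset in
lemma deep_case (P : Finset Pt) (hP : GenPos P) (m : ℕ) (hm : 0 < m)
    (L M R Y : Finset Pt) (hLP : L ⊆ P) (hRP : R ⊆ P) (hYP : Y ⊆ P)
    (hcov : P ⊆ L ∪ M ∪ R) (hM : M.card ≤ 8 * m + 1)
    (hLY : ∀ l ∈ L, ∀ y ∈ Y, l.1 < y.1) (hYR : ∀ y ∈ Y, ∀ r ∈ R, y.1 < r.1)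
    (hY : 2 * m ≤ Y.card)
    (hd1 : ∀ p ∈ Y, ∀ s, 12 * m < (P.filter (fun q => vl 1 s p ≤ vl 1 s q)).card)
    (hd2 : ∀ p ∈ Y, ∀ s, 12 * m < (P.filter (fun q => vl (-1) s p ≤ vl (-1) s q)).card) :
    NonCrossingFamily P m := by
  have hYn : Y.Nonempty := card_pos.1 (by omega)
  obtain ⟨Lu, Ru, hLu, hRu, cLu, cRu, hu⟩ := upper 1 one_ne_zero P hP m hm L M R Y hLP hRP hYP
    hcov hM hLY hYR hYn hd1
  obtain ⟨Ld, Rd, hLd, hRd, cLd, cRd, hd⟩ := upper (-1) (by norm_num) P hP m hm L M R Y hLP hRP hYP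
    hcov hM hLY hYR hYn hd2
  have hLR : ∀ l ∈ L, ∀ r ∈ R, l.1 < r.1 := by
    obtain ⟨y, hy⟩ := hYn
    intro l hl r hr
    exact (hLY l hl y hy).trans (hYR y hy r hr)
  have dLY : Disjoint L Y := disj_of_lt _ _ hLY
  have dYR : Disjoint Y R := disj_of_lt _ _ hYR
  have dLR : Disjoint L R := disj_of_lt _ _ hLR
  obtain ⟨X', Y', Z', hX', hY', hZ', cX, cY, cZ, hor⟩ := split3 P hP m hm Lu Y Rd (hLu.trans hLP)
    hYP (hRd.trans hRP) (fun x hx => hLY x (hLu hx)) (fun y hy z hz => hYR y hy z (hRd hz))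
    cLu hY cRd
  rcases hor with ho | ho
  · obtain ⟨A, hA, hAc⟩ := exists_subset_card_eq cX
    have hAL : A ⊆ L := hA.trans (hX'.trans hLu)
    have hBL : Ld \ A ⊆ L := sdiff_subset.trans hLd
    have hZR : Z' ⊆ R := hZ'.trans hRd
    have hBc : m ≤ (Ld \ A).card := by
      have := le_card_sdiff A Ld
      omega
    refine ⟨A, Ld \ A, Z', Y', hAL.trans hLP, hBL.trans hLP, hZR.trans hRP, hY'.trans hYP,
      disjoint_sdiff, dLR.mono hAL hZR, dLY.mono hAL hY', dLR.mono hBL hZR, dLY.mono hBL hY',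
      (dYR.mono hY' hZR).symm, hAc.ge, hBc, cZ, cY, ?_⟩
    intro p₁ h1 p₂ h2 p₃ h3 p₄ h4
    have h2' : p₂ ∈ Ld := sdiff_subset h2
    have := hd p₂ h2' p₃ (hZ' h3) p₄ (hY' h4)
    exact tri_in2 p₁ p₂ p₃ p₄ (hLY _ (hAL h1) _ (hY' h4)) (hLY _ (hBL h2) _ (hY' h4))
      (hYR _ (hY' h4) _ (hZR h3)) (ho _ (hA h1) _ h3 _ h4) (by linarith)
  · obtain ⟨A, hA, hAc⟩ := exists_subset_card_eq cZ
    have hAR : A ⊆ R := hA.trans (hZ'.trans hRd)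
    have hBR : Ru \ A ⊆ R := sdiff_subset.trans hRu
    have hXL : X' ⊆ L := hX'.trans hLu
    have hBc : m ≤ (Ru \ A).card := by
      have := le_card_sdiff A Ru
      omega
    refine ⟨X', A, Ru \ A, Y', hXL.trans hLP, hAR.trans hRP, hBR.trans hRP, hY'.trans hYP,
      dLR.mono hXL hAR, dLR.mono hXL hBR, dLY.mono hXL hY', disjoint_sdiff,
      (dYR.mono hY' hAR).symm, (dYR.mono hY' hBR).symm, cX, hAc.ge, hBc, cY, ?_⟩
    intro p₁ h1 p₂ h2 p₃ h3 p₄ h4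
    have h3' : p₃ ∈ Ru := sdiff_subset h3
    have := hu p₁ (hX' h1) p₃ h3' p₄ (hY' h4)
    exact tri_in1 p₁ p₂ p₃ p₄ (hLY _ (hXL h1) _ (hY' h4)) (hYR _ (hY' h4) _ (hAR h2))
      (hYR _ (hY' h4) _ (hBR h3)) (ho _ h1 _ (hA h2) _ h4) (by linarith)

lemma collinear_vert (p q r : Pt) (h1 : q.1 = p.1) (h2 : r.1 = p.1) :
    Collinear ℝ ({p, q, r} : Set Pt) := by
  rw [collinear_iff_of_mem (p₀ := p) (by simp)]
  refine ⟨(0, 1), ?_⟩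
  have key : ∀ z : Pt, z.1 = p.1 → ∃ t : ℝ, z = t • ((0, 1) : Pt) +ᵥ p := by
    intro z hz
    refine ⟨z.2 - p.2, ?_⟩
    ext <;> simp [hz]
  rintro z (rfl | rfl | rfl)
  · exact key _ rfl
  · exact key _ h1
  · exact key _ h2

open Finset in
lemma vert_card (P : Finset Pt) (hP : GenPos P) (x : ℝ) :
    (P.filter (fun q => q.1 = x)).card ≤ 2 := by
  by_contra! hcon
  obtain ⟨a, b, c, ha, hb, hc, hab, hac, hbc⟩ := two_lt_card_iff.1 hcon
  rw [mem_filter] at ha hb hc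
  exact hP a ha.1 b hb.1 c hc.1 hab hac hbc
    (collinear_vert a b c (by rw [hb.2, ha.2]) (by rw [hc.2, ha.2]))

open Finset in
lemma find_slab (P D : Finset Pt) (hP : GenPos P) (m : ℕ) (hm : 0 < m) (hDP : D ⊆ P)
    (hD : P.card ≤ 2 * D.card) (hn : 16 * m ≤ P.card) :
    ∃ L M R Y : Finset Pt, L ⊆ P ∧ R ⊆ P ∧ Y ⊆ D ∧ P ⊆ L ∪ M ∪ R ∧ M.card ≤ 8 * m + 1 ∧
      (∀ l ∈ L, ∀ y ∈ Y, l.1 < y.1) ∧ (∀ y ∈ Y, ∀ r ∈ R, y.1 < r.1) ∧ 2 * m ≤ Y.card := by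
  set ρ : Pt → ℕ := fun p => (P.filter (fun q => q.1 < p.1)).card with hρ
  have hmono : ∀ p q : Pt, p.1 ≤ q.1 → ρ p ≤ ρ q := by
    intro p q hpq
    apply card_le_card
    intro x hx
    rw [mem_filter] at *
    exact ⟨hx.1, hx.2.trans_le hpq⟩
  have hlt : ∀ p q : Pt, ρ p < ρ q → p.1 < q.1 := by
    intro p q h
    by_contra! hc
    have := hmono _ _ hc
    omega
  have hbin : ∀ p q : Pt, ρ p / (8 * m) < ρ q / (8 * m) → p.1 < q.1 := by
    intro p q h
    apply hlt
    by_contra! hc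
    have := Nat.div_le_div_right (c := 8 * m) hc
    omega
  -- pigeonhole
  have hpig : ∃ j ∈ range (P.card / (8 * m) + 1),
      2 * m - 1 < (D.filter (fun p => ρ p / (8 * m) = j)).card := by
    apply exists_lt_card_fiber_of_mul_lt_card_of_maps_to
    · intro p hp
      rw [mem_range]
      have : ρ p ≤ P.card := card_le_card (filter_subset _ _)
      have := Nat.div_le_div_right (c := 8 * m) this
      omega
    · rw [card_range]
      have h1 := Nat.div_mul_le_self P.card (8 * m)
      set t := P.card / (8 * m)
      obtain ⟨u, rfl⟩ : ∃ u, m = u + 1 := ⟨m - 1, by omega⟩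
      have : 2 * (u + 1) - 1 = 2 * u + 1 := by omega
      rw [this]
      nlinarith
  obtain ⟨j, -, hj⟩ := hpig
  refine ⟨P.filter (fun p => ρ p / (8 * m) < j), P.filter (fun p => ρ p / (8 * m) = j),
    P.filter (fun p => j < ρ p / (8 * m)), D.filter (fun p => ρ p / (8 * m) = j),
    filter_subset _ _, filter_subset _ _, filter_subset _ _, ?_, ?_, ?_, ?_, by omega⟩
  · intro p hp
    simp only [mem_union, mem_filter, hp, true_and]
    omega
  · set M := P.filter (fun p => ρ p / (8 * m) = j) with hM
    rcases M.eq_empty_or_nonempty with h0 | h0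
    · rw [h0]; simp
    obtain ⟨a, ha, hamin⟩ := exists_min_image M (fun p => p.1) h0
    obtain ⟨b, hb, hbmax⟩ := exists_max_image M (fun p => p.1) h0
    have ha2 := (mem_filter.1 ha).2
    have hb2 := (mem_filter.1 hb).2
    have h1 : M ⊆ M.filter (fun q => q.1 < b.1) ∪ P.filter (fun q => q.1 = b.1) := by
      intro q hq
      have hqP := (mem_filter.1 hq).1
      simp only [mem_union, mem_filter, hq, hqP, true_and]
      exact (hbmax q hq).lt_or_eq
    have h2 : M.filter (fun q => q.1 < b.1) ∪ P.filter (fun q => q.1 < a.1) ⊆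
        P.filter (fun q => q.1 < b.1) := by
      intro q hq
      rw [mem_union] at hq
      rcases hq with hq | hq
      · rw [mem_filter] at hq
        exact mem_filter.2 ⟨(mem_filter.1 hq.1).1, hq.2⟩
      · rw [mem_filter] at hq
        exact mem_filter.2 ⟨hq.1, hq.2.trans_le (hamin b hb)⟩
    have h3 : Disjoint (M.filter (fun q => q.1 < b.1)) (P.filter (fun q => q.1 < a.1)) := by
      rw [disjoint_left]
      intro q hq hq'
      have := hamin q (mem_filter.1 hq).1
      have := (mem_filter.1 hq').2
      linarith
    have k1 := card_le_card h1
    have k2 := card_union_le (M.filter (fun q => q.1 < b.1)) (P.filter (fun q => q.1 = b.1))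
    have k3 := card_le_card h2
    rw [card_union_of_disjoint h3] at k3
    have k4 := vert_card P hP b.1
    have ea : j * (8 * m) ≤ ρ a := by
      rw [← ha2]; exact Nat.div_mul_le_self _ _
    have eb : ρ b < (j + 1) * (8 * m) := by
      rw [← hb2]; 
      have := Nat.lt_div_mul_add (a := ρ b) (b := 8 * m) (by omega)
      rw [add_mul]; omega
    have ea' : ρ a = (P.filter (fun q => q.1 < a.1)).card := rfl
    have eb' : ρ b = (P.filter (fun q => q.1 < b.1)).card := rfl
    rw [add_mul] at eb
    omega
  · intro l hl y hy
    apply hbin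
    rw [(mem_filter.1 hy).2]
    exact (mem_filter.1 hl).2
  · intro y hy r hr
    apply hbin
    rw [(mem_filter.1 hy).2]
    exact (mem_filter.1 hr).2

/-- There is a constant `C > 0` such that for all positive integers `m` and `k`,
every finite planar point set `P` in general position with `|P| ≥ C·k·m` contains either a
convex bundle of size `k` and width `m` or a non-crossing family of size `m`. -/
theorem stmt0 :
    ∃ C : ℝ, 0 < C ∧ ∀ m k : ℕ, 0 < m → 0 < k →
      ∀ P : Finset Pt, GenPos P → C * (k : ℝ) * (m : ℝ) ≤ (P.card : ℝ) →
        ConvexBundle P k m ∨ NonCrossingFamily P m := by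
  refine ⟨400, by norm_num, ?_⟩
  intro m k hm hk P hP hcard
  have hcard : 400 * k * m ≤ P.card := by exact_mod_cast hcard
  have hkm : m ≤ k * m := Nat.le_mul_of_pos_left m hk
  have hc2 : 400 * (k * m) ≤ P.card := by rw [← mul_assoc]; exact hcard
  have hc3 : k * (m + 4 * (12 * m)) = 49 * (k * m) := by ring
  have main : ∀ e : ℝ, P.card ≤ 4 * (P.filter (fun p =>
      ∃ s, (P.filter (fun q => vl e s p ≤ vl e s q)).card ≤ 12 * m)).card →
      ConvexBundle P k m := by
    intro e he
    refine shallow_case P (hSP := Finset.filter_subset _ _) (e := e) (h := 12 * m) (k := k) (m := m) (hS := ?_) (hc := ?_) (S := P.filter (fun p =>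
      ∃ s, (P.filter (fun q => vl e s p ≤ vl e s q)).card ≤ 12 * m))
    · intro p hp
      obtain ⟨s, hs⟩ := (Finset.mem_filter.1 hp).2
      refine ⟨s, le_trans (Finset.card_le_card ?_) hs⟩
      exact Finset.filter_subset_filter _ (Finset.filter_subset _ _)
    · omega
  by_cases h1 : P.card ≤ 4 * (P.filter (fun p =>
      ∃ s, (P.filter (fun q => vl 1 s p ≤ vl 1 s q)).card ≤ 12 * m)).card
  · exact Or.inl (main 1 h1)
  by_cases h2 : P.card ≤ 4 * (P.filter (fun p =>
      ∃ s, (P.filter (fun q => vl (-1) s p ≤ vl (-1) s q)).card ≤ 12 * m)).card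
  · exact Or.inl (main (-1) h2)
  right
  set S₁ := P.filter (fun p =>
      ∃ s, (P.filter (fun q => vl 1 s p ≤ vl 1 s q)).card ≤ 12 * m)
  set S₂ := P.filter (fun p =>
      ∃ s, (P.filter (fun q => vl (-1) s p ≤ vl (-1) s q)).card ≤ 12 * m)
  have hD : P.card ≤ 2 * (P \ (S₁ ∪ S₂)).card := by
    have a1 := Finset.le_card_sdiff (S₁ ∪ S₂) P
    have a2 := Finset.card_union_le S₁ S₂
    omega
  obtain ⟨L, M, R, Y, hL, hR, hY, hcov, hM, hLY, hYR, hYc⟩ :=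
    find_slab P (P \ (S₁ ∪ S₂)) hP m hm Finset.sdiff_subset hD (by omega)
  refine deep_case P hP m hm L M R Y hL hR (hY.trans Finset.sdiff_subset) hcov hM hLY hYR hYc ?_ ?_
  · intro p hp s
    obtain ⟨hpP, hpn⟩ := Finset.mem_sdiff.1 (hY hp)
    by_contra! hcon
    exact hpn (Finset.mem_union_left _ (Finset.mem_filter.2 ⟨hpP, s, hcon⟩))
  · intro p hp s
    obtain ⟨hpP, hpn⟩ := Finset.mem_sdiff.1 (hY hp)
    by_contra! hcon
    exact hpn (Finset.mem_union_right _ (Finset.mem_filter.2 ⟨hpP, s, hcon⟩))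
end

section
/- There is a constant C > 0 such that for all positive integers m and k, every finite set P of points in the plane in general position with |P| ≥ C·k·m contains either a crossing family of size k or a non-crossing family of size m. -/
open scoped Classical

/-- Signed height of `p` over the line `y = s x + c`. -/
def ev (L : ℝ × ℝ) (p : Pt) : ℝ := p.2 - L.1 * p.1 - L.2

/-- Orientation determinant of `u - t`, `v - t`. -/
def cr (u v t : Pt) : ℝ := (u.1 - t.1) * (v.2 - t.2) - (u.2 - t.2) * (v.1 - t.1)

lemma tri_interior_s1 (t p₁ p₂ p₃ : Pt) (h1 : 0 < cr p₁ p₃ t) (h2 : 0 < cr p₃ p₂ t)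
    (h3 : 0 < cr p₂ p₁ t) : t ∈ interior (convexHull ℝ ({p₁, p₂, p₃} : Set Pt)) := by
  rw [mem_interior]
  refine ⟨{z | 0 < cr p₁ p₃ z} ∩ {z | 0 < cr p₃ p₂ z} ∩ {z | 0 < cr p₂ p₁ z}, ?_, ?_,
    ⟨⟨h1, h2⟩, h3⟩⟩
  · rintro z ⟨⟨ha, hb⟩, hc⟩
    simp only [Set.mem_ofPred_eq] at ha hb hc
    have hD : 0 < cr p₁ p₃ z + cr p₃ p₂ z + cr p₂ p₁ z := by positivity
    have hz : z = (cr p₃ p₂ z / (cr p₁ p₃ z + cr p₃ p₂ z + cr p₂ p₁ z)) • p₁ +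
        (cr p₁ p₃ z / (cr p₁ p₃ z + cr p₃ p₂ z + cr p₂ p₁ z)) • p₂ +
        (cr p₂ p₁ z / (cr p₁ p₃ z + cr p₃ p₂ z + cr p₂ p₁ z)) • p₃ := by
      have hne := hD.ne'
      ext
      · simp only [Prod.fst_add, Prod.smul_fst, smul_eq_mul]
        field_simp
        unfold cr; ring
      · simp only [Prod.snd_add, Prod.smul_snd, smul_eq_mul]
        field_simp
        unfold cr; ring
    have hconv := convex_convexHull ℝ ({p₁, p₂, p₃} : Set Pt)
    have m1 : p₁ ∈ convexHull ℝ ({p₁, p₂, p₃} : Set Pt) := subset_convexHull ℝ _ (by simp)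
    have m2 : p₂ ∈ convexHull ℝ ({p₁, p₂, p₃} : Set Pt) := subset_convexHull ℝ _ (by simp)
    have m3 : p₃ ∈ convexHull ℝ ({p₁, p₂, p₃} : Set Pt) := subset_convexHull ℝ _ (by simp)
    rw [hz]
    have := hconv.sum_mem (t := Finset.univ) (w := ![cr p₃ p₂ z / (cr p₁ p₃ z + cr p₃ p₂ z + cr p₂ p₁ z),
      cr p₁ p₃ z / (cr p₁ p₃ z + cr p₃ p₂ z + cr p₂ p₁ z),
      cr p₂ p₁ z / (cr p₁ p₃ z + cr p₃ p₂ z + cr p₂ p₁ z)]) (z := ![p₁, p₂, p₃])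
      (by intro i _; fin_cases i <;> simp <;> positivity)
      (by simp [Fin.sum_univ_three]; field_simp; ring)
      (by intro i _; fin_cases i <;> simp [m1, m2, m3])
    simpa [Fin.sum_univ_three] using this
  · have hc : ∀ u v : Pt, IsOpen {z | 0 < cr u v z} := by
      intro u v
      apply isOpen_lt continuous_const
      unfold cr; fun_prop
    exact ((hc _ _).inter (hc _ _)).inter (hc _ _)

lemma ncf_of_cr (P : Finset Pt) (m : ℕ) (hm : 0 < m) (P₁ P₂ P₃ P₄ : Finset Pt)
    (s1 : P₁ ⊆ P) (s2 : P₂ ⊆ P) (s3 : P₃ ⊆ P) (s4 : P₄ ⊆ P)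
    (c1 : m ≤ P₁.card) (c2 : m ≤ P₂.card) (c3 : m ≤ P₃.card) (c4 : m ≤ P₄.card)
    (h : ∀ p₁ ∈ P₁, ∀ p₂ ∈ P₂, ∀ p₃ ∈ P₃, ∀ t ∈ P₄,
      0 < cr p₁ p₃ t ∧ 0 < cr p₃ p₂ t ∧ 0 < cr p₂ p₁ t) : NonCrossingFamily P m := by
  obtain ⟨a1, ha1⟩ : P₁.Nonempty := Finset.card_pos.mp (by omega)
  obtain ⟨a2, ha2⟩ : P₂.Nonempty := Finset.card_pos.mp (by omega)
  obtain ⟨a3, ha3⟩ : P₃.Nonempty := Finset.card_pos.mp (by omega)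
  obtain ⟨a4, ha4⟩ : P₄.Nonempty := Finset.card_pos.mp (by omega)
  refine ⟨P₁, P₂, P₃, P₄, s1, s2, s3, s4, ?_, ?_, ?_, ?_, ?_, ?_, c1, c2, c3, c4, ?_⟩
  · rw [Finset.disjoint_left]; intro x hx hy
    have := (h x hx x hy a3 ha3 a4 ha4).2.2
    unfold cr at this; nlinarith
  · rw [Finset.disjoint_left]; intro x hx hy
    have := (h x hx a2 ha2 x hy a4 ha4).1
    unfold cr at this; nlinarith
  · rw [Finset.disjoint_left]; intro x hx hy
    have := (h x hx a2 ha2 a3 ha3 x hy).1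
    unfold cr at this; nlinarith
  · rw [Finset.disjoint_left]; intro x hx hy
    have := (h a1 ha1 x hx x hy a4 ha4).2.1
    unfold cr at this; nlinarith
  · rw [Finset.disjoint_left]; intro x hx hy
    have := (h a1 ha1 x hx a3 ha3 x hy).2.1
    unfold cr at this; nlinarith
  · rw [Finset.disjoint_left]; intro x hx hy
    have := (h a1 ha1 a2 ha2 x hx x hy).1
    unfold cr at this; nlinarith
  · intro p₁ h₁ p₂ h₂ p₃ h₃ t h₄
    obtain ⟨u, v, w⟩ := h p₁ h₁ p₂ h₂ p₃ h₃ t h₄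
    exact tri_interior_s1 t p₁ p₂ p₃ u v w

/-- The sign conditions (relative to three slopes) which put `0` inside a triangle. -/
lemma dir_lemma (sj si sl x1 y1 x2 y2 x3 y3 : ℝ) (hji : sj ≤ si) (hil : si ≤ sl)
    (h1a : 0 < y1 - sj * x1) (h1b : y1 - si * x1 < 0)
    (h2a : y2 - si * x2 < 0) (h2b : 0 < y2 - sl * x2)
    (h3a : 0 < y3 - sj * x3) (h3b : 0 < y3 - sl * x3) :
    0 < x1 * y3 - y1 * x3 ∧ 0 < x3 * y2 - y3 * x2 ∧ 0 < x2 * y1 - y2 * x1 := by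
  have hx1 : 0 < x1 := by
    by_contra hx; push Not at hx
    nlinarith [mul_nonneg (sub_nonneg.2 hji) (neg_nonneg.2 hx)]
  have hx2 : x2 < 0 := by
    by_contra hx; push Not at hx
    nlinarith [mul_nonneg (sub_nonneg.2 hil) hx]
  have hjl : sj < sl := by
    have : 0 < (si - sj) * x1 := by linarith
    have := pos_of_mul_pos_left this hx1.le
    linarith
  have b1 : y1 - sl * x1 < 0 := by nlinarith [mul_nonneg (sub_nonneg.2 hil) hx1.le]
  have a2 : y2 - sj * x2 < 0 := by
    nlinarith [mul_nonneg (sub_nonneg.2 hji) (neg_nonneg.2 hx2.le)]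
  have hpos : 0 < sl - sj := by linarith
  refine ⟨?_, ?_, ?_⟩
  · have : 0 < (sl - sj) * (x1 * y3 - y1 * x3) := by
      have e : (sl - sj) * (x1 * y3 - y1 * x3) =
        (y1 - sj * x1) * (y3 - sl * x3) - (y1 - sl * x1) * (y3 - sj * x3) := by ring
      rw [e]
      nlinarith [mul_pos h1a h3b, mul_pos (neg_pos.2 b1) h3a]
    exact (mul_pos_iff_of_pos_left hpos).1 this
  · have : 0 < (sl - sj) * (x3 * y2 - y3 * x2) := by
      have e : (sl - sj) * (x3 * y2 - y3 * x2) =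
        (y3 - sj * x3) * (y2 - sl * x2) - (y3 - sl * x3) * (y2 - sj * x2) := by ring
      rw [e]
      nlinarith [mul_pos h3a h2b, mul_pos (neg_pos.2 a2) h3b]
    exact (mul_pos_iff_of_pos_left hpos).1 this
  · have k1 : y1 < si * x1 := by linarith
    have k2 : y2 < si * x2 := by linarith
    nlinarith [mul_pos (sub_pos.2 k1) (neg_pos.2 hx2), mul_pos (sub_pos.2 k2) hx1]

lemma dir_cr (sj si sl : ℝ) (v1 v2 v3 t : Pt) (hji : sj ≤ si) (hil : si ≤ sl)
    (h1a : 0 < (v1.2 - t.2) - sj * (v1.1 - t.1)) (h1b : (v1.2 - t.2) - si * (v1.1 - t.1) < 0)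
    (h2a : (v2.2 - t.2) - si * (v2.1 - t.1) < 0) (h2b : 0 < (v2.2 - t.2) - sl * (v2.1 - t.1))
    (h3a : 0 < (v3.2 - t.2) - sj * (v3.1 - t.1)) (h3b : 0 < (v3.2 - t.2) - sl * (v3.1 - t.1)) :
    0 < cr v1 v3 t ∧ 0 < cr v3 v2 t ∧ 0 < cr v2 v1 t := by
  unfold cr
  exact dir_lemma sj si sl _ _ _ _ _ _ hji hil h1a h1b h2a h2b h3a h3b

lemma dir_cr' (sj si sl : ℝ) (v1 v2 v3 t : Pt) (hji : sj ≤ si) (hil : si ≤ sl)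
    (h1a : (v1.2 - t.2) - sj * (v1.1 - t.1) < 0) (h1b : 0 < (v1.2 - t.2) - si * (v1.1 - t.1))
    (h2a : 0 < (v2.2 - t.2) - si * (v2.1 - t.1)) (h2b : (v2.2 - t.2) - sl * (v2.1 - t.1) < 0)
    (h3a : (v3.2 - t.2) - sj * (v3.1 - t.1) < 0) (h3b : (v3.2 - t.2) - sl * (v3.1 - t.1) < 0) :
    0 < cr v1 v3 t ∧ 0 < cr v3 v2 t ∧ 0 < cr v2 v1 t := by
  obtain ⟨a, b, c⟩ := dir_lemma (-sl) (-si) (-sj) (v2.1 - t.1) (-(v2.2 - t.2)) (v1.1 - t.1)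
    (-(v1.2 - t.2)) (v3.1 - t.1) (-(v3.2 - t.2)) (by linarith) (by linarith) (by linarith)
    (by linarith) (by linarith) (by linarith) (by linarith) (by linarith)
  unfold cr
  refine ⟨by linarith, by linarith, by linarith⟩

/-- The line `L` has at least `|P|/2 - e` points strictly on each side. -/
def NH (P : Finset Pt) (e : ℕ) (L : ℝ × ℝ) : Prop :=
  P.card ≤ 2 * (P.filter (fun p => 0 < ev L p)).card + 2 * e ∧
  P.card ≤ 2 * (P.filter (fun p => ev L p < 0)).card + 2 * e

lemma card_inter_ge (P A B T : Finset Pt) (e : ℕ) (hA : A ⊆ P) (hB : B ⊆ P) (hT : T ⊆ P)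
    (cA : P.card ≤ 2 * A.card + 2 * e) (cB : P.card ≤ 2 * B.card + 2 * e)
    (dA : Disjoint A T) (dB : Disjoint B T) : T.card ≤ (A ∩ B).card + 2 * e := by
  have h1 := Finset.card_union_add_card_inter A B
  have h2 : ((A ∪ B) ∪ T).card = (A ∪ B).card + T.card :=
    Finset.card_union_of_disjoint (Finset.disjoint_union_left.2 ⟨dA, dB⟩)
  have h3 : ((A ∪ B) ∪ T).card ≤ P.card :=
    Finset.card_le_card (Finset.union_subset (Finset.union_subset hA hB) hT)
  omega

lemma tri_bound (P : Finset Pt) (m e : ℕ) (hm : 0 < m) (hN : ¬ NonCrossingFamily P m)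
    (a b c : ℝ × ℝ) (ha : NH P e a) (hb : NH P e b) (hc : NH P e c)
    (hab : a.1 ≤ b.1) (hbc : b.1 ≤ c.1) :
    (P.filter (fun p => ev a p ≤ 0 ∧ 0 ≤ ev b p ∧ ev c p ≤ 0)).card ≤ m + 2 * e := by
  by_contra hcon
  push Not at hcon
  set T := P.filter (fun p => ev a p ≤ 0 ∧ 0 ≤ ev b p ∧ ev c p ≤ 0) with hT
  have hTs : T ⊆ P := Finset.filter_subset _ _
  have dA : Disjoint (P.filter (fun p => 0 < ev a p)) T := by
    rw [Finset.disjoint_left]; intro x hx hy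
    simp only [hT, Finset.mem_filter] at hx hy; linarith [hx.2, hy.2.1]
  have dB : Disjoint (P.filter (fun p => ev b p < 0)) T := by
    rw [Finset.disjoint_left]; intro x hx hy
    simp only [hT, Finset.mem_filter] at hx hy; linarith [hx.2, hy.2.2.1]
  have dC : Disjoint (P.filter (fun p => 0 < ev c p)) T := by
    rw [Finset.disjoint_left]; intro x hx hy
    simp only [hT, Finset.mem_filter] at hx hy; linarith [hx.2, hy.2.2.2]
  have fs : ∀ q : Pt → Prop, P.filter q ⊆ P := fun q => Finset.filter_subset _ _
  have k1 := card_inter_ge P _ _ T e (fs _) (fs _) hTs ha.1 hb.2 dA dB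
  have k2 := card_inter_ge P _ _ T e (fs _) (fs _) hTs hb.2 hc.1 dB dC
  have k3 := card_inter_ge P _ _ T e (fs _) (fs _) hTs ha.1 hc.1 dA dC
  apply hN
  refine ncf_of_cr P m hm
    (P.filter (fun p => 0 < ev a p) ∩ P.filter (fun p => ev b p < 0))
    (P.filter (fun p => ev b p < 0) ∩ P.filter (fun p => 0 < ev c p))
    (P.filter (fun p => 0 < ev a p) ∩ P.filter (fun p => 0 < ev c p)) T
    (Finset.inter_subset_left.trans (fs _))
    (Finset.inter_subset_left.trans (fs _)) (Finset.inter_subset_left.trans (fs _)) hTs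
    (by omega) (by omega) (by omega) (by omega) ?_
  intro p1 h1 p2 h2 p3 h3 t ht
  simp only [hT, Finset.mem_filter, Finset.mem_inter] at h1 h2 h3 ht
  simp only [ev] at h1 h2 h3 ht
  apply dir_cr a.1 b.1 c.1 p1 p2 p3 t hab hbc <;> linarith [h1.1.2, h1.2.2, h2.1.2, h2.2.2, h3.1.2,
    h3.2.2, ht.2.1, ht.2.2.1, ht.2.2.2]

lemma tri_bound' (P : Finset Pt) (m e : ℕ) (hm : 0 < m) (hN : ¬ NonCrossingFamily P m)
    (a b c : ℝ × ℝ) (ha : NH P e a) (hb : NH P e b) (hc : NH P e c)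
    (hab : a.1 ≤ b.1) (hbc : b.1 ≤ c.1) :
    (P.filter (fun p => 0 ≤ ev a p ∧ ev b p ≤ 0 ∧ 0 ≤ ev c p)).card ≤ m + 2 * e := by
  by_contra hcon
  push Not at hcon
  set T := P.filter (fun p => 0 ≤ ev a p ∧ ev b p ≤ 0 ∧ 0 ≤ ev c p) with hT
  have hTs : T ⊆ P := Finset.filter_subset _ _
  have dA : Disjoint (P.filter (fun p => ev a p < 0)) T := by
    rw [Finset.disjoint_left]; intro x hx hy
    simp only [hT, Finset.mem_filter] at hx hy; linarith [hx.2, hy.2.1]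
  have dB : Disjoint (P.filter (fun p => 0 < ev b p)) T := by
    rw [Finset.disjoint_left]; intro x hx hy
    simp only [hT, Finset.mem_filter] at hx hy; linarith [hx.2, hy.2.2.1]
  have dC : Disjoint (P.filter (fun p => ev c p < 0)) T := by
    rw [Finset.disjoint_left]; intro x hx hy
    simp only [hT, Finset.mem_filter] at hx hy; linarith [hx.2, hy.2.2.2]
  have fs : ∀ q : Pt → Prop, P.filter q ⊆ P := fun q => Finset.filter_subset _ _
  have k1 := card_inter_ge P _ _ T e (fs _) (fs _) hTs ha.2 hb.1 dA dB
  have k2 := card_inter_ge P _ _ T e (fs _) (fs _) hTs hb.1 hc.2 dB dC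
  have k3 := card_inter_ge P _ _ T e (fs _) (fs _) hTs ha.2 hc.2 dA dC
  apply hN
  refine ncf_of_cr P m hm
    (P.filter (fun p => ev a p < 0) ∩ P.filter (fun p => 0 < ev b p))
    (P.filter (fun p => 0 < ev b p) ∩ P.filter (fun p => ev c p < 0))
    (P.filter (fun p => ev a p < 0) ∩ P.filter (fun p => ev c p < 0)) T
    (Finset.inter_subset_left.trans (fs _))
    (Finset.inter_subset_left.trans (fs _)) (Finset.inter_subset_left.trans (fs _)) hTs
    (by omega) (by omega) (by omega) (by omega) ?_
  intro p1 h1 p2 h2 p3 h3 t ht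
  simp only [hT, Finset.mem_filter, Finset.mem_inter] at h1 h2 h3 ht
  simp only [ev] at h1 h2 h3 ht
  apply dir_cr' a.1 b.1 c.1 p1 p2 p3 t hab hbc <;> linarith [h1.1.2, h1.2.2, h2.1.2, h2.2.2, h3.1.2,
    h3.2.2, ht.2.1, ht.2.2.1, ht.2.2.2]


/-- One gap in the zone lemma. -/
lemma zone_gap {α β δ : Type} (P : Finset α) (x y : α → ℝ) (s c : β → ℝ)
    (R : Finset β) (Γ : Finset δ) (g : δ → ℝ) (lo hi : δ → β) (T : ℕ)
    (H1 : ∀ γ ∈ Γ, s (lo γ) < g γ ∧ g γ < s (hi γ))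
    (H2 : ∀ L ∈ R, ∀ γ ∈ Γ, s L ≤ s (lo γ) ∨ s (hi γ) ≤ s L)
    (H3 : ∀ γ ∈ Γ, ∀ γ' ∈ Γ, g γ < g γ' → ∃ L ∈ R, g γ < s L ∧ s L < g γ')
    (H4 : ∀ a b d : β, s a ≤ s b → s b ≤ s d →
      (P.filter (fun p => y p - s a * x p - c a ≤ 0 ∧ 0 ≤ y p - s b * x p - c b ∧
        y p - s d * x p - c d ≤ 0)).card ≤ T)
    (H4' : ∀ a b d : β, s a ≤ s b → s b ≤ s d →
      (P.filter (fun p => 0 ≤ y p - s a * x p - c a ∧ y p - s b * x p - c b ≤ 0 ∧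
        0 ≤ y p - s d * x p - c d)).card ≤ T)
    (On : β → δ → Prop)
    (hOn : ∀ j γ, On j γ ↔ s j < g γ ∧ ∃ z : ℝ, ∀ L ∈ R, s L < g γ → s L * z + c L ≤ s j * z + c j)
    (γ : δ) (hγ : γ ∈ Γ) :
    (P.filter (fun p => 0 ≤ y p - s (lo γ) * x p - c (lo γ) ∧
      y p - s (hi γ) * x p - c (hi γ) ≤ 0 ∧
      ∃ L ∈ R, s L < g γ ∧ y p - s L * x p - c L ≤ 0)).card ≤
    (2 + (R.filter (fun j => On j γ ∧ ∀ γ' ∈ Γ, g γ < g γ' → ¬ On j γ')).card) * T := by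
  set Pop := R.filter (fun j => On j γ ∧ ∀ γ' ∈ Γ, g γ < g γ' → ¬ On j γ') with hPop
  let TT : β → Finset α := fun j => P.filter (fun p => y p - s j * x p - c j ≤ 0 ∧
    0 ≤ y p - s (lo γ) * x p - c (lo γ) ∧ y p - s (hi γ) * x p - c (hi γ) ≤ 0)
  have hTT : ∀ j ∈ R, s j < g γ → (TT j).card ≤ T := by
    intro j hj hs
    refine H4 j (lo γ) (hi γ) ?_ ((H1 γ hγ).1.trans (H1 γ hγ).2).le
    rcases H2 j hj γ hγ with h | h
    · exact h
    · linarith [(H1 γ hγ).2]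
  have hbi : (Pop.biUnion TT).card ≤ Pop.card * T := by
    apply Finset.card_biUnion_le_card_mul
    intro j hj
    rw [hPop, Finset.mem_filter] at hj
    exact hTT j hj.1 ((hOn j γ).1 hj.2.1).1
  -- the upper envelope line over a bad point
  have key : ∀ p, (∃ L ∈ R, s L < g γ ∧ y p - s L * x p - c L ≤ 0) →
      ∃ j ∈ R, s j < g γ ∧ y p - s j * x p - c j ≤ 0 ∧
        ∀ L ∈ R, s L < g γ → s L * x p + c L ≤ s j * x p + c j := by
    rintro p ⟨L, hL, hLs, hLp⟩
    obtain ⟨j, hj, hmax⟩ := Finset.exists_max_image (R.filter (fun L => s L < g γ))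
      (fun L => s L * x p + c L) ⟨L, Finset.mem_filter.2 ⟨hL, hLs⟩⟩
    rw [Finset.mem_filter] at hj
    have := hmax L (Finset.mem_filter.2 ⟨hL, hLs⟩)
    refine ⟨j, hj.1, hj.2, by linarith, fun M hM hMs => hmax M (Finset.mem_filter.2 ⟨hM, hMs⟩)⟩
  by_cases hE : (R.filter (fun j => s j < g γ ∧ ∃ γ' ∈ Γ, g γ < g γ' ∧ On j γ')).Nonempty
  · obtain ⟨js, hjs, hjmax⟩ := Finset.exists_max_image _ s hE
    rw [Finset.mem_filter] at hjs
    obtain ⟨hjsR, hjss, γ2, hγ2, hlt, hon⟩ := hjs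
    obtain ⟨L0, hL0, hL0a, hL0b⟩ := H3 γ hγ γ2 hγ2 hlt
    obtain ⟨N, hN, hNmin⟩ := Finset.exists_min_image (R.filter (fun L => g γ < s L)) s
      ⟨L0, Finset.mem_filter.2 ⟨hL0, hL0a⟩⟩
    rw [Finset.mem_filter] at hN
    have hNL := hNmin L0 (Finset.mem_filter.2 ⟨hL0, hL0a⟩)
    obtain ⟨_, z, hz⟩ := (hOn js γ2).1 hon
    let X1 : Finset α := P.filter (fun p => 0 ≤ y p - s (lo γ) * x p - c (lo γ) ∧
      y p - s (hi γ) * x p - c (hi γ) ≤ 0 ∧ 0 ≤ y p - s N * x p - c N)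
    have hX1 : X1.card ≤ T := by
      refine H4' (lo γ) (hi γ) N ((H1 γ hγ).1.trans (H1 γ hγ).2).le ?_
      rcases H2 N hN.1 γ hγ with h | h
      · linarith [(H1 γ hγ).1, hN.2]
      · exact h
    have hX2 := hTT js hjsR hjss
    have hsub : (P.filter (fun p => 0 ≤ y p - s (lo γ) * x p - c (lo γ) ∧
        y p - s (hi γ) * x p - c (hi γ) ≤ 0 ∧
        ∃ L ∈ R, s L < g γ ∧ y p - s L * x p - c L ≤ 0)) ⊆ (Pop.biUnion TT ∪ X1) ∪ TT js := by
      intro p hp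
      rw [Finset.mem_filter] at hp
      obtain ⟨hpP, hplo, hphi, hbad⟩ := hp
      obtain ⟨j, hj, hjs', hjp, hjmx⟩ := key p hbad
      by_cases hpop : j ∈ Pop
      · refine Finset.mem_union_left _ (Finset.mem_union_left _ ?_)
        exact Finset.mem_biUnion.2 ⟨j, hpop, Finset.mem_filter.2 ⟨hpP, hjp, hplo, hphi⟩⟩
      by_cases hNp : 0 ≤ y p - s N * x p - c N
      · refine Finset.mem_union_left _ (Finset.mem_union_right _ ?_)
        exact Finset.mem_filter.2 ⟨hpP, hplo, hphi, hNp⟩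
      refine Finset.mem_union_right _ (Finset.mem_filter.2 ⟨hpP, ?_, hplo, hphi⟩)
      have hjon : On j γ := (hOn j γ).2 ⟨hjs', x p, hjmx⟩
      have hjE : ∃ γ' ∈ Γ, g γ < g γ' ∧ On j γ' := by
        by_contra hcon
        push Not at hcon
        exact hpop (Finset.mem_filter.2 ⟨hj, hjon, hcon⟩)
      have hsl : s j ≤ s js := hjmax j (Finset.mem_filter.2 ⟨hj, hjs', hjE⟩)
      have e1 := hz N hN.1 (by linarith)
      have e2 := hz j hj (by linarith)
      have e3 := hjmx js hjsR hjss
      push Not at hNp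
      rcases hsl.eq_or_lt with h | h
      · rw [h] at e2 hjp; linarith
      · have hx : x p ≤ z := by
          by_contra hlt'; push Not at hlt'
          nlinarith [mul_pos (sub_pos.2 h) (sub_pos.2 hlt')]
        have hNs : s js ≤ s N := by linarith [hN.2]
        nlinarith [mul_nonneg (sub_nonneg.2 hNs) (sub_nonneg.2 hx)]
    have h1 := Finset.card_le_card hsub
    have h2 := Finset.card_union_le (Pop.biUnion TT ∪ X1) (TT js)
    have h3 := Finset.card_union_le (Pop.biUnion TT) X1
    calc _ ≤ Pop.card * T + T + T := by omega
      _ = _ := by ring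
  · have hsub : (P.filter (fun p => 0 ≤ y p - s (lo γ) * x p - c (lo γ) ∧
        y p - s (hi γ) * x p - c (hi γ) ≤ 0 ∧
        ∃ L ∈ R, s L < g γ ∧ y p - s L * x p - c L ≤ 0)) ⊆ Pop.biUnion TT := by
      intro p hp
      rw [Finset.mem_filter] at hp
      obtain ⟨hpP, hplo, hphi, hbad⟩ := hp
      obtain ⟨j, hj, hjs', hjp, hjmx⟩ := key p hbad
      have hjon : On j γ := (hOn j γ).2 ⟨hjs', x p, hjmx⟩
      refine Finset.mem_biUnion.2 ⟨j, Finset.mem_filter.2 ⟨hj, hjon, ?_⟩,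
        Finset.mem_filter.2 ⟨hpP, hjp, hplo, hphi⟩⟩
      intro γ' hγ' hl hon
      exact hE ⟨j, Finset.mem_filter.2 ⟨hj, hjs', γ', hγ', hl, hon⟩⟩
    have h1 := Finset.card_le_card hsub
    calc _ ≤ Pop.card * T := by omega
      _ ≤ _ := Nat.mul_le_mul_right _ (by omega)

lemma zone_rl {α β δ : Type} (P : Finset α) (x y : α → ℝ) (s c : β → ℝ)
    (R : Finset β) (Γ : Finset δ) (g : δ → ℝ) (lo hi : δ → β) (T : ℕ)
    (H1 : ∀ γ ∈ Γ, s (lo γ) < g γ ∧ g γ < s (hi γ))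
    (H2 : ∀ L ∈ R, ∀ γ ∈ Γ, s L ≤ s (lo γ) ∨ s (hi γ) ≤ s L)
    (H3 : ∀ γ ∈ Γ, ∀ γ' ∈ Γ, γ ≠ γ' →
      ∃ L ∈ R, (g γ < s L ∧ s L < g γ') ∨ (g γ' < s L ∧ s L < g γ))
    (H4 : ∀ a b d : β, s a ≤ s b → s b ≤ s d →
      (P.filter (fun p => y p - s a * x p - c a ≤ 0 ∧ 0 ≤ y p - s b * x p - c b ∧
        y p - s d * x p - c d ≤ 0)).card ≤ T)
    (H4' : ∀ a b d : β, s a ≤ s b → s b ≤ s d →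
      (P.filter (fun p => 0 ≤ y p - s a * x p - c a ∧ y p - s b * x p - c b ≤ 0 ∧
        0 ≤ y p - s d * x p - c d)).card ≤ T) :
    ∑ γ ∈ Γ, (P.filter (fun p => 0 ≤ y p - s (lo γ) * x p - c (lo γ) ∧
      y p - s (hi γ) * x p - c (hi γ) ≤ 0 ∧
      ∃ L ∈ R, s L < g γ ∧ y p - s L * x p - c L ≤ 0)).card ≤ (2 * Γ.card + R.card) * T := by
  obtain ⟨On, hOn⟩ : ∃ On : β → δ → Prop, ∀ j γ, On j γ ↔
    s j < g γ ∧ ∃ z : ℝ, ∀ L ∈ R, s L < g γ → s L * z + c L ≤ s j * z + c j :=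
    ⟨_, fun _ _ => Iff.rfl⟩
  have H3' : ∀ γ ∈ Γ, ∀ γ' ∈ Γ, g γ < g γ' → ∃ L ∈ R, g γ < s L ∧ s L < g γ' := by
    intro γ hγ γ' hγ' hl
    obtain ⟨L, hL, h | h⟩ := H3 γ hγ γ' hγ' (by rintro rfl; exact lt_irrefl _ hl)
    · exact ⟨L, hL, h⟩
    · linarith
  let Pop : δ → Finset β :=
    fun γ => R.filter (fun j => On j γ ∧ ∀ γ' ∈ Γ, g γ < g γ' → ¬ On j γ')
  have hdis : (Γ : Set δ).PairwiseDisjoint Pop := by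
    intro γ hγ γ' hγ' hne
    rw [Function.onFun, Finset.disjoint_left]
    intro j hj hj'
    rw [Finset.mem_filter] at hj hj'
    obtain ⟨L, hL, h | h⟩ := H3 γ hγ γ' hγ' hne
    · exact hj.2.2 γ' hγ' (by linarith) hj'.2.1
    · exact hj'.2.2 γ hγ (by linarith) hj.2.1
  have hPopsum : ∑ γ ∈ Γ, (Pop γ).card ≤ R.card := by
    rw [← Finset.card_biUnion hdis]
    exact Finset.card_le_card (Finset.biUnion_subset.2 fun γ _ => Finset.filter_subset _ _)
  calc _ ≤ ∑ γ ∈ Γ, (2 + (Pop γ).card) * T := Finset.sum_le_sum fun γ hγ =>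
        zone_gap P x y s c R Γ g lo hi T H1 H2 H3' H4 H4' On hOn γ hγ
    _ = (2 * Γ.card + ∑ γ ∈ Γ, (Pop γ).card) * T := by
        rw [← Finset.sum_mul, Finset.sum_add_distrib]; simp [mul_comm]
    _ ≤ _ := Nat.mul_le_mul_right _ (by omega)

lemma zone_ru {α β δ : Type} (P : Finset α) (x y : α → ℝ) (s c : β → ℝ)
    (R : Finset β) (Γ : Finset δ) (g : δ → ℝ) (lo hi : δ → β) (T : ℕ)
    (H1 : ∀ γ ∈ Γ, s (lo γ) < g γ ∧ g γ < s (hi γ))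
    (H2 : ∀ L ∈ R, ∀ γ ∈ Γ, s L ≤ s (lo γ) ∨ s (hi γ) ≤ s L)
    (H3 : ∀ γ ∈ Γ, ∀ γ' ∈ Γ, γ ≠ γ' →
      ∃ L ∈ R, (g γ < s L ∧ s L < g γ') ∨ (g γ' < s L ∧ s L < g γ))
    (H4 : ∀ a b d : β, s a ≤ s b → s b ≤ s d →
      (P.filter (fun p => y p - s a * x p - c a ≤ 0 ∧ 0 ≤ y p - s b * x p - c b ∧
        y p - s d * x p - c d ≤ 0)).card ≤ T)
    (H4' : ∀ a b d : β, s a ≤ s b → s b ≤ s d →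
      (P.filter (fun p => 0 ≤ y p - s a * x p - c a ∧ y p - s b * x p - c b ≤ 0 ∧
        0 ≤ y p - s d * x p - c d)).card ≤ T) :
    ∑ γ ∈ Γ, (P.filter (fun p => 0 ≤ y p - s (lo γ) * x p - c (lo γ) ∧
      y p - s (hi γ) * x p - c (hi γ) ≤ 0 ∧
      ∃ L ∈ R, g γ < s L ∧ 0 ≤ y p - s L * x p - c L)).card ≤ (2 * Γ.card + R.card) * T := by
  have := zone_rl P x (fun p => - y p) (fun L => - s L) (fun L => - c L) R Γ (fun γ => - g γ) hi lo T
    (fun γ hγ => ⟨by linarith [(H1 γ hγ).2], by linarith [(H1 γ hγ).1]⟩)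
    (fun L hL γ hγ => (H2 L hL γ hγ).symm.imp (by intro h; linarith) (by intro h; linarith))
    (fun γ hγ γ' hγ' hne => by
      obtain ⟨L, hL, h⟩ := H3 γ hγ γ' hγ' hne
      exact ⟨L, hL, h.symm.imp (fun h => ⟨by linarith, by linarith⟩)
        (fun h => ⟨by linarith, by linarith⟩)⟩)
    (fun a b d hab hbd => (Finset.card_le_card (Finset.monotone_filter_right _ (by
      intro p _ hp; exact ⟨by linarith [hp.2.2], by linarith [hp.2.1], by linarith [hp.1]⟩))).trans
      (H4' d b a (by linarith) (by linarith)))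
    (fun a b d hab hbd => (Finset.card_le_card (Finset.monotone_filter_right _ (by
      intro p _ hp; exact ⟨by linarith [hp.2.2], by linarith [hp.2.1], by linarith [hp.1]⟩))).trans
      (H4 d b a (by linarith) (by linarith)))
  refine le_trans (Finset.sum_le_sum fun γ hγ => ?_) this
  refine Finset.card_le_card (Finset.monotone_filter_right _ ?_)
  rintro p _ ⟨h1, h2, L, hL, h3, h4⟩
  exact ⟨by linarith, by linarith, L, hL, by linarith, by linarith⟩

lemma zone_ll {α β δ : Type} (P : Finset α) (x y : α → ℝ) (s c : β → ℝ)
    (R : Finset β) (Γ : Finset δ) (g : δ → ℝ) (lo hi : δ → β) (T : ℕ)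
    (H1 : ∀ γ ∈ Γ, s (lo γ) < g γ ∧ g γ < s (hi γ))
    (H2 : ∀ L ∈ R, ∀ γ ∈ Γ, s L ≤ s (lo γ) ∨ s (hi γ) ≤ s L)
    (H3 : ∀ γ ∈ Γ, ∀ γ' ∈ Γ, γ ≠ γ' →
      ∃ L ∈ R, (g γ < s L ∧ s L < g γ') ∨ (g γ' < s L ∧ s L < g γ))
    (H4 : ∀ a b d : β, s a ≤ s b → s b ≤ s d →
      (P.filter (fun p => y p - s a * x p - c a ≤ 0 ∧ 0 ≤ y p - s b * x p - c b ∧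
        y p - s d * x p - c d ≤ 0)).card ≤ T)
    (H4' : ∀ a b d : β, s a ≤ s b → s b ≤ s d →
      (P.filter (fun p => 0 ≤ y p - s a * x p - c a ∧ y p - s b * x p - c b ≤ 0 ∧
        0 ≤ y p - s d * x p - c d)).card ≤ T) :
    (∑ γ ∈ Γ, (P.filter (fun p => y p - s (lo γ) * x p - c (lo γ) ≤ 0 ∧
      0 ≤ y p - s (hi γ) * x p - c (hi γ) ∧
      ∃ L ∈ R, s L < g γ ∧ 0 ≤ y p - s L * x p - c L)).card ≤ (2 * Γ.card + R.card) * T) ∧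
    (∑ γ ∈ Γ, (P.filter (fun p => y p - s (lo γ) * x p - c (lo γ) ≤ 0 ∧
      0 ≤ y p - s (hi γ) * x p - c (hi γ) ∧
      ∃ L ∈ R, g γ < s L ∧ y p - s L * x p - c L ≤ 0)).card ≤ (2 * Γ.card + R.card) * T) := by
  have K1 : ∀ a b d : β, s a ≤ s b → s b ≤ s d →
      (P.filter (fun p => - y p - s a * - x p - - c a ≤ 0 ∧ 0 ≤ - y p - s b * - x p - - c b ∧
        - y p - s d * - x p - - c d ≤ 0)).card ≤ T :=
    (fun a b d hab hbd => (Finset.card_le_card (Finset.monotone_filter_right _ (by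
      intro p _ hp; exact ⟨by linarith [hp.1], by linarith [hp.2.1], by linarith [hp.2.2]⟩))).trans
      (H4' a b d (by linarith) (by linarith)))
  have K2 : ∀ a b d : β, s a ≤ s b → s b ≤ s d →
      (P.filter (fun p => 0 ≤ - y p - s a * - x p - - c a ∧ - y p - s b * - x p - - c b ≤ 0 ∧
        0 ≤ - y p - s d * - x p - - c d)).card ≤ T :=
    (fun a b d hab hbd => (Finset.card_le_card (Finset.monotone_filter_right _ (by
      intro p _ hp; exact ⟨by linarith [hp.1], by linarith [hp.2.1], by linarith [hp.2.2]⟩))).trans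
      (H4 a b d (by linarith) (by linarith)))
  constructor
  · have := zone_rl P (fun p => - x p) (fun p => - y p) s (fun L => - c L) R Γ g lo hi T H1 H2 H3 K1 K2
    refine le_trans (Finset.sum_le_sum fun γ hγ => ?_) this
    refine Finset.card_le_card (Finset.monotone_filter_right _ ?_)
    rintro p _ ⟨h1, h2, L, hL, h3, h4⟩
    exact ⟨by linarith, by linarith, L, hL, by linarith, by linarith⟩
  · have := zone_ru P (fun p => - x p) (fun p => - y p) s (fun L => - c L) R Γ g lo hi T H1 H2 H3 K1 K2
    refine le_trans (Finset.sum_le_sum fun γ hγ => ?_) this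
    refine Finset.card_le_card (Finset.monotone_filter_right _ ?_)
    rintro p _ ⟨h1, h2, L, hL, h3, h4⟩
    exact ⟨by linarith, by linarith, L, hL, by linarith, by linarith⟩

lemma NH.mono {P : Finset Pt} {e e' : ℕ} {L : ℝ × ℝ} (h : NH P e L) (he : e ≤ e') : NH P e' L := by
  unfold NH at *
  omega

lemma zoneP {β δ : Type} (P : Finset Pt) (m e : ℕ) (hm : 0 < m) (hN : ¬ NonCrossingFamily P m)
    (ℓ : β → ℝ × ℝ) (hNH : ∀ b, NH P e (ℓ b))
    (R : Finset β) (Γ : Finset δ) (g : δ → ℝ) (lo hi : δ → β)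
    (H1 : ∀ γ ∈ Γ, (ℓ (lo γ)).1 < g γ ∧ g γ < (ℓ (hi γ)).1)
    (H2 : ∀ L ∈ R, ∀ γ ∈ Γ, (ℓ L).1 ≤ (ℓ (lo γ)).1 ∨ (ℓ (hi γ)).1 ≤ (ℓ L).1)
    (H3 : ∀ γ ∈ Γ, ∀ γ' ∈ Γ, γ ≠ γ' →
      ∃ L ∈ R, (g γ < (ℓ L).1 ∧ (ℓ L).1 < g γ') ∨ (g γ' < (ℓ L).1 ∧ (ℓ L).1 < g γ)) :
    (∑ γ ∈ Γ, (P.filter (fun p => 0 ≤ ev (ℓ (lo γ)) p ∧ ev (ℓ (hi γ)) p ≤ 0 ∧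
      ((∃ L ∈ R, (ℓ L).1 < g γ ∧ ev (ℓ L) p ≤ 0) ∨
        (∃ L ∈ R, g γ < (ℓ L).1 ∧ 0 ≤ ev (ℓ L) p)))).card ≤
        2 * ((2 * Γ.card + R.card) * (m + 2 * e))) ∧
    (∑ γ ∈ Γ, (P.filter (fun p => ev (ℓ (lo γ)) p ≤ 0 ∧ 0 ≤ ev (ℓ (hi γ)) p ∧
      ((∃ L ∈ R, (ℓ L).1 < g γ ∧ 0 ≤ ev (ℓ L) p) ∨
        (∃ L ∈ R, g γ < (ℓ L).1 ∧ ev (ℓ L) p ≤ 0)))).card ≤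
        2 * ((2 * Γ.card + R.card) * (m + 2 * e))) := by
  have H4 : ∀ a b d : β, (ℓ a).1 ≤ (ℓ b).1 → (ℓ b).1 ≤ (ℓ d).1 →
      (P.filter (fun p => p.2 - (ℓ a).1 * p.1 - (ℓ a).2 ≤ 0 ∧ 0 ≤ p.2 - (ℓ b).1 * p.1 - (ℓ b).2 ∧
        p.2 - (ℓ d).1 * p.1 - (ℓ d).2 ≤ 0)).card ≤ m + 2 * e := fun a b d h1 h2 =>
    tri_bound P m e hm hN _ _ _ (hNH a) (hNH b) (hNH d) h1 h2
  have H4' : ∀ a b d : β, (ℓ a).1 ≤ (ℓ b).1 → (ℓ b).1 ≤ (ℓ d).1 →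
      (P.filter (fun p => 0 ≤ p.2 - (ℓ a).1 * p.1 - (ℓ a).2 ∧ p.2 - (ℓ b).1 * p.1 - (ℓ b).2 ≤ 0 ∧
        0 ≤ p.2 - (ℓ d).1 * p.1 - (ℓ d).2)).card ≤ m + 2 * e := fun a b d h1 h2 =>
    tri_bound' P m e hm hN _ _ _ (hNH a) (hNH b) (hNH d) h1 h2
  have rl := zone_rl P (fun p : Pt => p.1) (fun p : Pt => p.2) (fun b => (ℓ b).1) (fun b => (ℓ b).2)
    R Γ g lo hi (m + 2 * e) H1 H2 H3 H4 H4'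
  have ru := zone_ru P (fun p : Pt => p.1) (fun p : Pt => p.2) (fun b => (ℓ b).1) (fun b => (ℓ b).2)
    R Γ g lo hi (m + 2 * e) H1 H2 H3 H4 H4'
  obtain ⟨ll, lu⟩ := zone_ll P (fun p : Pt => p.1) (fun p : Pt => p.2) (fun b => (ℓ b).1)
    (fun b => (ℓ b).2) R Γ g lo hi (m + 2 * e) H1 H2 H3 H4 H4'
  constructor
  · rw [two_mul]
    refine le_trans ?_ (add_le_add rl ru)
    rw [← Finset.sum_add_distrib]
    refine Finset.sum_le_sum fun γ hγ => ?_
    refine le_trans (Finset.card_le_card ?_) (Finset.card_union_le _ _)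
    intro p hp
    rw [Finset.mem_filter] at hp
    obtain ⟨hP, h1, h2, h | h⟩ := hp
    · exact Finset.mem_union_left _ (Finset.mem_filter.2 ⟨hP, h1, h2, h⟩)
    · exact Finset.mem_union_right _ (Finset.mem_filter.2 ⟨hP, h1, h2, h⟩)
  · rw [two_mul]
    refine le_trans ?_ (add_le_add ll lu)
    rw [← Finset.sum_add_distrib]
    refine Finset.sum_le_sum fun γ hγ => ?_
    refine le_trans (Finset.card_le_card ?_) (Finset.card_union_le _ _)
    intro p hp
    rw [Finset.mem_filter] at hp
    obtain ⟨hP, h1, h2, h | h⟩ := hp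
    · exact Finset.mem_union_left _ (Finset.mem_filter.2 ⟨hP, h1, h2, h⟩)
    · exact Finset.mem_union_right _ (Finset.mem_filter.2 ⟨hP, h1, h2, h⟩)


lemma coll_slope (P : Finset Pt) (hP : GenPos P) (σ : ℝ) (p q r : Pt) (hp : p ∈ P) (hq : q ∈ P)
    (hr : r ∈ P) (hpq : p ≠ q) (hpr : p ≠ r) (hqr : q ≠ r)
    (h1 : p.2 - r.2 = σ * (p.1 - r.1)) (h2 : q.2 - r.2 = σ * (q.1 - r.1)) : False := by
  apply hP p hp q hq r hr hpq hpr hqr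
  rw [collinear_iff_of_mem (p₀ := r) (by simp)]
  refine ⟨((1, σ) : Pt), ?_⟩
  intro z hz
  simp only [Set.mem_insert_iff, Set.mem_singleton_iff] at hz
  refine ⟨z.1 - r.1, ?_⟩
  rcases hz with rfl | rfl | rfl
  · ext
    · simp
    · simp; linarith
  · ext
    · simp
    · simp; linarith
  · ext <;> simp

lemma coll_vert (P : Finset Pt) (hP : GenPos P) (p q r : Pt) (hp : p ∈ P) (hq : q ∈ P)
    (hr : r ∈ P) (hpq : p ≠ q) (hpr : p ≠ r) (hqr : q ≠ r)
    (h1 : p.1 = r.1) (h2 : q.1 = r.1) : False := by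
  apply hP p hp q hq r hr hpq hpr hqr
  rw [collinear_iff_of_mem (p₀ := r) (by simp)]
  refine ⟨((0, 1) : Pt), ?_⟩
  intro z hz
  simp only [Set.mem_insert_iff, Set.mem_singleton_iff] at hz
  refine ⟨z.2 - r.2, ?_⟩
  rcases hz with rfl | rfl | rfl
  · ext <;> simp [h1]
  · ext <;> simp [h2]
  · ext <;> simp

lemma count_below (B : Finset ℝ) (i : ℕ) (hi : i ≤ B.card) :
    ∃ t, t ∉ B ∧ (B.filter (fun b => b < t)).card = i := by
  induction i with
  | zero =>
    obtain ⟨t0, ht0⟩ := B.finite_toSet.bddBelow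
    have hlt : ∀ b ∈ B, t0 - 1 < b := fun b hb => by linarith [ht0 (Finset.mem_coe.2 hb)]
    refine ⟨t0 - 1, fun h => lt_irrefl _ (hlt _ h), ?_⟩
    rw [Finset.card_eq_zero, Finset.filter_eq_empty_iff]
    intro b hb
    exact not_lt.2 (hlt b hb).le
  | succ i ih =>
    obtain ⟨t, htB, ht⟩ := ih (by omega)
    have hne : (B.filter (fun b => t < b)).Nonempty := by
      by_contra hcon
      rw [Finset.not_nonempty_iff_eq_empty, Finset.filter_eq_empty_iff] at hcon
      have : B.filter (fun b => b < t) = B := by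
        rw [Finset.filter_eq_self]
        intro b hb
        rcases lt_trichotomy b t with h | h | h
        · exact h
        · exact absurd (h ▸ hb) htB
        · exact absurd h (hcon hb)
      rw [this] at ht
      omega
    obtain ⟨b0, hb0, hmin⟩ := Finset.exists_min_image _ (fun b => b) hne
    rw [Finset.mem_filter] at hb0
    obtain ⟨t', ht'1, ht'2⟩ : ∃ t', b0 < t' ∧ ∀ b ∈ B, b0 < b → t' < b := by
      by_cases h2 : (B.filter (fun b => b0 < b)).Nonempty
      · obtain ⟨b1, hb1, hmin1⟩ := Finset.exists_min_image _ (fun b => b) h2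
        rw [Finset.mem_filter] at hb1
        refine ⟨(b0 + b1) / 2, by linarith [hb1.2], fun b hb hbb => ?_⟩
        have := hmin1 b (Finset.mem_filter.2 ⟨hb, hbb⟩)
        linarith [hb1.2]
      · refine ⟨b0 + 1, by linarith, fun b hb hbb => ?_⟩
        exact absurd ⟨b, Finset.mem_filter.2 ⟨hb, hbb⟩⟩ h2
    refine ⟨t', fun h => lt_irrefl _ (ht'2 t' h ht'1), ?_⟩
    have : B.filter (fun b => b < t') = insert b0 (B.filter (fun b => b < t)) := by
      ext b
      simp only [Finset.mem_filter, Finset.mem_insert]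
      constructor
      · rintro ⟨hb, hbt⟩
        rcases lt_trichotomy b t with h | h | h
        · exact Or.inr ⟨hb, h⟩
        · exact absurd (h ▸ hb) htB
        · left
          have := hmin b (Finset.mem_filter.2 ⟨hb, h⟩)
          by_contra hne'
          have h3 : b0 < b := lt_of_le_of_ne this (Ne.symm hne')
          linarith [ht'2 b hb h3]
      · rintro (rfl | ⟨hb, hbt⟩)
        · exact ⟨hb0.1, ht'1⟩
        · exact ⟨hb, by linarith [hb0.2]⟩
    rw [this, Finset.card_insert_of_notMem, ht]
    rw [Finset.mem_filter]
    rintro ⟨_, h⟩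
    linarith [hb0.2]

/-- At a non-critical slope there is a line with any prescribed number of points above. -/
lemma line_at (P : Finset Pt) (t : ℝ)
    (hinj : ∀ p ∈ P, ∀ q ∈ P, p.2 - t * p.1 = q.2 - t * q.1 → p = q) (h : ℕ) (hh : h ≤ P.card) :
    ∃ c, (∀ p ∈ P, ev (t, c) p ≠ 0) ∧ (P.filter (fun p => 0 < ev (t, c) p)).card = h ∧
      (P.filter (fun p => ev (t, c) p < 0)).card = P.card - h := by
  have hcard : (P.image (fun p => p.2 - t * p.1)).card = P.card :=
    Finset.card_image_of_injOn (fun p hp q hq e => hinj p hp q hq e)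
  obtain ⟨c, hc, hcnt⟩ := count_below (P.image (fun p => p.2 - t * p.1)) (P.card - h) (by omega)
  have hne : ∀ p ∈ P, ev (t, c) p ≠ 0 := by
    intro p hp h0
    apply hc
    rw [Finset.mem_image]
    refine ⟨p, hp, ?_⟩
    simp only [ev] at h0
    linarith
  have hneg : (P.filter (fun p => ev (t, c) p < 0)).card = P.card - h := by
    rw [← hcnt, Finset.filter_image, Finset.card_image_of_injOn]
    · congr 1
      ext p
      simp only [Finset.mem_filter]
      simp only [ev]
      constructor <;> rintro ⟨a, b⟩ <;> exact ⟨a, by linarith⟩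
    · intro p hp q hq e
      rw [Finset.mem_coe, Finset.mem_filter] at hp hq
      exact hinj p hp.1 q hq.1 e
  refine ⟨c, hne, ?_, hneg⟩
  have h2 := Finset.card_filter_add_card_filter_not (s := P) (fun p => ev (t, c) p < 0)
  have h3 : P.filter (fun p => ¬ ev (t, c) p < 0) = P.filter (fun p => 0 < ev (t, c) p) := by
    apply Finset.filter_congr
    intro p hp
    rw [not_lt]
    exact ⟨fun h => lt_of_le_of_ne h (hne p hp).symm, le_of_lt⟩
  rw [h3] at h2
  omega

lemma fine_lines (P : Finset Pt) (hP : GenPos P) (h : ℕ) (hh : h ≤ P.card) :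
    ∃ (M : ℕ) (ℓ : ℕ → ℝ × ℝ),
      (∀ i j, i < j → j ≤ M → (ℓ i).1 < (ℓ j).1) ∧
      (∀ i ≤ M, (∀ p ∈ P, ev (ℓ i) p ≠ 0) ∧ (P.filter (fun p => 0 < ev (ℓ i) p)).card = h ∧
        (P.filter (fun p => ev (ℓ i) p < 0)).card = P.card - h) ∧
      (∀ i < M, (P.filter (fun p => 0 < ev (ℓ i) p) \
        P.filter (fun p => 0 < ev (ℓ (i + 1)) p)).card ≤ 1) ∧
      (∀ p ∈ P, ∀ q ∈ P, 0 < ev (ℓ 0) p → 0 < ev (ℓ M) p → ev (ℓ 0) q < 0 → ev (ℓ M) q < 0 →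
        q.1 = p.1) := by
  set B : Finset ℝ := ((P ×ˢ P).filter (fun z => z.1.1 ≠ z.2.1)).image
    (fun z => (z.1.2 - z.2.2) / (z.1.1 - z.2.1)) with hB
  have hBmem : ∀ p ∈ P, ∀ q ∈ P, p.1 ≠ q.1 →
      ∃ σ ∈ B, p.2 - q.2 = σ * (p.1 - q.1) := by
    intro p hp q hq hne
    refine ⟨(p.2 - q.2) / (p.1 - q.1), ?_, ?_⟩
    · rw [hB, Finset.mem_image]
      exact ⟨(p, q), by simp [hp, hq, hne], rfl⟩
    · rw [div_mul_cancel₀]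
      exact sub_ne_zero.2 hne
  have hex : ∀ i, ∃ L : ℝ × ℝ, i ≤ B.card → (B.filter (fun b => b < L.1)).card = i ∧ L.1 ∉ B ∧
      (∀ p ∈ P, ev L p ≠ 0) ∧ (P.filter (fun p => 0 < ev L p)).card = h ∧
        (P.filter (fun p => ev L p < 0)).card = P.card - h := by
    intro i
    by_cases hi : i ≤ B.card
    · obtain ⟨t, htB, ht⟩ := count_below B i hi
      obtain ⟨c, hc⟩ := line_at P t (by
        intro p hp q hq e
        by_cases hx : p.1 = q.1
        · refine Prod.ext hx ?_
          rw [hx] at e; linarith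
        · exfalso
          obtain ⟨σ, hσ, e2⟩ := hBmem p hp q hq hx
          have : (σ - t) * (p.1 - q.1) = 0 := by linarith
          rcases mul_eq_zero.1 this with h0 | h0
          · have : σ = t := by linarith
            exact htB (this ▸ hσ)
          · exact hx (by linarith)) h hh
      exact ⟨(t, c), fun _ => ⟨ht, htB, hc⟩⟩
    · exact ⟨(0, 0), fun h => absurd h hi⟩
  choose ℓ hℓ using hex
  have mono : ∀ i j, i < j → j ≤ B.card → (ℓ i).1 < (ℓ j).1 := by
    intro i j hij hj
    by_contra hcon
    push Not at hcon
    have h1 := (hℓ i (by omega)).1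
    have h2 := (hℓ j hj).1
    have : B.filter (fun b => b < (ℓ j).1) ⊆ B.filter (fun b => b < (ℓ i).1) :=
      Finset.monotone_filter_right _ (fun b _ hb => lt_of_lt_of_le hb hcon)
    have := Finset.card_le_card this
    omega
  -- a swap forces a critical slope in between
  have swap : ∀ i j, (ℓ i).1 < (ℓ j).1 → ∀ p ∈ P, ∀ q ∈ P, 0 < ev (ℓ i) p → ev (ℓ i) q < 0 →
      ev (ℓ j) p < 0 → 0 < ev (ℓ j) q → ∃ σ ∈ B, p.2 - q.2 = σ * (p.1 - q.1) ∧ (ℓ i).1 < σ ∧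
        σ < (ℓ j).1 := by
    intro i j hij p hp q hq h1 h2 h3 h4
    simp only [ev] at h1 h2 h3 h4
    have hx : 0 < p.1 - q.1 := by
      by_contra hcon
      push Not at hcon
      nlinarith [mul_nonneg (sub_nonneg.2 hij.le) (neg_nonneg.2 hcon)]
    obtain ⟨σ, hσ, e⟩ := hBmem p hp q hq (by intro h; rw [h] at hx; linarith)
    refine ⟨σ, hσ, e, ?_, ?_⟩
    · by_contra hcon
      push Not at hcon
      nlinarith [mul_nonneg (sub_nonneg.2 hcon) hx.le]
    · by_contra hcon
      push Not at hcon
      nlinarith [mul_nonneg (sub_nonneg.2 hcon) hx.le]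
  refine ⟨B.card, ℓ, mono, fun i hi => (hℓ i hi).2.2, ?_, ?_⟩
  · intro i hi
    rw [Finset.card_le_one]
    intro p hp p' hp'
    by_contra hne
    obtain ⟨ci, -, nei, ai, -⟩ := hℓ i (by omega)
    obtain ⟨cj, -, nej, aj, -⟩ := hℓ (i + 1) (by omega)
    have hlt := mono i (i + 1) (by omega) (by omega)
    have hq : (P.filter (fun p => 0 < ev (ℓ (i + 1)) p) \
        P.filter (fun p => 0 < ev (ℓ i) p)).Nonempty := by
      rw [← Finset.card_pos, ← Finset.card_sdiff_comm (ai.trans aj.symm)]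
      exact Finset.card_pos.2 ⟨p, hp⟩
    obtain ⟨q, hq⟩ := hq
    simp only [Finset.mem_sdiff, Finset.mem_filter, not_and, not_lt] at hp hp' hq
    have np : ev (ℓ (i + 1)) p < 0 := lt_of_le_of_ne (hp.2 hp.1.1) (nej p hp.1.1)
    have np' : ev (ℓ (i + 1)) p' < 0 := lt_of_le_of_ne (hp'.2 hp'.1.1) (nej p' hp'.1.1)
    have nq : ev (ℓ i) q < 0 := lt_of_le_of_ne (hq.2 hq.1.1) (nei q hq.1.1)
    obtain ⟨σ, hσ, e, l1, l2⟩ := swap i (i + 1) hlt p hp.1.1 q hq.1.1 hp.1.2 nq np hq.1.2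
    obtain ⟨σ', hσ', e', l1', l2'⟩ := swap i (i + 1) hlt p' hp'.1.1 q hq.1.1 hp'.1.2 nq np' hq.1.2
    have hone : (B.filter (fun b => b < (ℓ (i + 1)).1) \ B.filter (fun b => b < (ℓ i).1)).card = 1 := by
      rw [Finset.card_sdiff_of_subset
        (Finset.monotone_filter_right _ (fun b _ hb => lt_trans hb hlt)), ci, cj]
      omega
    have heq : σ = σ' := by
      refine Finset.card_le_one.1 hone.le σ ?_ σ' ?_
      · simp only [Finset.mem_sdiff, Finset.mem_filter, not_and, not_lt]
        exact ⟨⟨hσ, l2⟩, fun _ => l1.le⟩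
      · simp only [Finset.mem_sdiff, Finset.mem_filter, not_and, not_lt]
        exact ⟨⟨hσ', l2'⟩, fun _ => l1'.le⟩
    rw [← heq] at e'
    refine coll_slope P hP σ p p' q hp.1.1 hp'.1.1 hq.1.1 hne ?_ ?_ e e'
    · rintro rfl; linarith [hp.1.2]
    · rintro rfl; linarith [hp'.1.2]
  · intro p hp q hq h1 h2 h3 h4
    by_contra hne
    obtain ⟨σ, hσ, e⟩ := hBmem p hp q hq (fun h => hne h.symm)
    obtain ⟨c0, n0, -⟩ := hℓ 0 (by omega)
    obtain ⟨cM, nM, -⟩ := hℓ B.card le_rfl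
    have s0 : (ℓ 0).1 < σ := by
      rw [Finset.card_eq_zero, Finset.filter_eq_empty_iff] at c0
      refine lt_of_le_of_ne (not_lt.1 (c0 hσ)) ?_
      intro h; exact n0 (h ▸ hσ)
    have sM : σ < (ℓ B.card).1 := by
      have := Finset.filter_eq_self.1 (Finset.eq_of_subset_of_card_le (Finset.filter_subset _ _) cM.ge)
      exact this σ hσ
    simp only [ev] at h1 h2 h3 h4
    rcases le_or_gt (p.1 - q.1) 0 with h | h
    · nlinarith [mul_nonneg (sub_nonneg.2 s0.le) (neg_nonneg.2 h)]
    · nlinarith [mul_nonneg (sub_nonneg.2 sM.le) h.le]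

lemma greedy (A : ℕ → Finset Pt) (M w : ℕ) (hw : 0 < w)
    (hstep : ∀ i < M, (A i \ A (i + 1)).card ≤ 1) :
    ∀ d a, a + d = M → ∃ (K : ℕ) (idx : ℕ → ℕ), idx 0 = a ∧ (∀ i < K, idx i < idx (i + 1)) ∧
      (∀ i ≤ K, idx i ≤ M) ∧ (∀ i < K, (A (idx i) \ A (idx (i + 1))).card = w) ∧
      (A a \ A M).card < (K + 1) * w := by
  intro d
  induction d using Nat.strong_induction_on with
  | _ d ih =>
    intro a ha
    by_cases hlt : (A a \ A M).card < w
    · exact ⟨0, fun _ => a, rfl, by simp, fun _ _ => by show a ≤ M; omega, by simp, by simpa using hlt⟩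
    push Not at hlt
    have hex : ∃ i, w ≤ (A a \ A (a + i)).card := ⟨d, by rw [ha]; exact hlt⟩
    set i := Nat.find hex with hi
    have hiw : w ≤ (A a \ A (a + i)).card := Nat.find_spec hex
    have hid : i ≤ d := Nat.find_min' hex (by rw [ha]; exact hlt)
    have hi0 : i ≠ 0 := by
      intro h0
      rw [h0] at hiw
      simp at hiw
      omega
    obtain ⟨i', hi'⟩ := Nat.exists_eq_succ_of_ne_zero hi0
    have hprev : (A a \ A (a + i')).card < w := by
      have := Nat.find_min hex (m := i') (by omega)
      omega
    have tri : ∀ X Y Z : Finset Pt, (X \ Z).card ≤ (X \ Y).card + (Y \ Z).card := by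
      intro X Y Z
      refine le_trans (Finset.card_le_card ?_) (Finset.card_union_le _ _)
      intro z hz
      simp only [Finset.mem_sdiff, Finset.mem_union] at *
      tauto
    have hst := hstep (a + i') (by omega)
    have heq : (A a \ A (a + i)).card = w := by
      have := tri (A a) (A (a + i')) (A (a + i))
      rw [hi', Nat.succ_eq_add_one, ← add_assoc] at this hiw ⊢
      omega
    obtain ⟨K, idx, h0, h1, h2, h3, h4⟩ := ih (d - i) (by omega) (a + i) (by omega)
    refine ⟨K + 1, fun n => Nat.casesOn n a idx, rfl, ?_, ?_, ?_, ?_⟩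
    · intro n hn
      cases n with
      | zero => show a < idx 0; omega
      | succ n => exact h1 n (by omega)
    · intro n hn
      cases n with
      | zero => show a ≤ M; omega
      | succ n => exact h2 n (by omega)
    · intro n hn
      cases n with
      | zero => show (A a \ A (idx 0)).card = w; rw [h0]; exact heq
      | succ n => exact h3 n (by omega)
    · have := tri (A a) (A (a + i)) (A M)
      have e : (K + 1 + 1) * w = w + (K + 1) * w := by ring
      omega

lemma base_lines (P : Finset Pt) (hP : GenPos P) (w : ℕ) (hw : 0 < w) :
    ∃ (K : ℕ) (ℓ : ℕ → ℝ × ℝ),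
      (∀ i j, i < j → j ≤ K → (ℓ i).1 < (ℓ j).1) ∧
      (∀ i ≤ K, (∀ p ∈ P, ev (ℓ i) p ≠ 0)) ∧ (∀ i, NH P 1 (ℓ i)) ∧
      (∀ i < K, (P.filter (fun p => 0 < ev (ℓ i) p ∧ ev (ℓ (i + 1)) p < 0)).card = w) ∧
      (∀ i < K, (P.filter (fun p => ev (ℓ i) p < 0 ∧ 0 < ev (ℓ (i + 1)) p)).card = w) ∧
      P.card / 2 ≤ (K + 1) * w := by
  obtain ⟨M, L, hmono, hhalf, hstep, hends⟩ := fine_lines P hP (P.card / 2) (by omega)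
  obtain ⟨K, idx, h0, hidx, hM, hw', hlast⟩ :=
    greedy (fun i => P.filter (fun p => 0 < ev (L i) p)) M w hw hstep M 0 (by omega)
  have hidx' : ∀ i j, i < j → j ≤ K → idx i < idx j := by
    intro i j hij
    induction j, hij using Nat.le_induction with
    | base => intro h; exact hidx i (by omega)
    | succ j hj ih => intro h; exact (ih (by omega)).trans (hidx j (by omega))
  have sd : ∀ i ≤ M, ∀ j ≤ M, P.filter (fun p => 0 < ev (L i) p) \ P.filter (fun p => 0 < ev (L j) p)
      = P.filter (fun p => 0 < ev (L i) p ∧ ev (L j) p < 0) := by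
    intro i hi j hj
    ext p
    simp only [Finset.mem_sdiff, Finset.mem_filter, not_and, not_lt]
    constructor
    · rintro ⟨⟨a, b⟩, c⟩
      exact ⟨a, b, lt_of_le_of_ne (c a) ((hhalf j hj).1 p a)⟩
    · rintro ⟨a, b, c⟩
      exact ⟨⟨a, b⟩, fun _ => c.le⟩
  refine ⟨K, fun i => L (idx (min i K)), ?_, ?_, ?_, ?_, ?_, ?_⟩
  · intro i j hij hj
    have := hidx' i j hij hj
    have h2 := hM j hj
    simp only
    rw [min_eq_left hj, min_eq_left (by omega : i ≤ K)]
    exact hmono _ _ this h2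
  · intro i hi
    simp only
    exact (hhalf _ (hM _ (by omega))).1
  · intro i
    obtain ⟨-, a, b⟩ := hhalf _ (hM (min i K) (by omega))
    unfold NH
    rw [a, b]
    omega
  · intro i hi
    have := hw' i hi
    simp only at this ⊢
    rw [min_eq_left (by omega : i ≤ K), min_eq_left (by omega : i + 1 ≤ K)]
    rw [← this, sd _ (hM _ (by omega)) _ (hM _ (by omega))]
  · intro i hi
    have := hw' i hi
    simp only at this ⊢
    rw [min_eq_left (by omega : i ≤ K), min_eq_left (by omega : i + 1 ≤ K)]
    rw [← this, Finset.card_sdiff_comm, sd _ (hM _ (by omega)) _ (hM _ (by omega))]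
    · congr 1
      ext p
      simp only [Finset.mem_filter]
      tauto
    · rw [(hhalf _ (hM i (by omega))).2.1, (hhalf _ (hM (i + 1) (by omega))).2.1]
  · have key : (P.filter (fun p => 0 < ev (L 0) p) ∩ P.filter (fun p => 0 < ev (L M) p)).card ≤ 1 := by
      by_contra hcon
      push Not at hcon
      have u := Finset.card_union_add_card_inter (P.filter (fun p => 0 < ev (L 0) p))
        (P.filter (fun p => 0 < ev (L M) p))
      rw [(hhalf 0 (by omega)).2.1, (hhalf M le_rfl).2.1] at u
      have hsub : P.filter (fun p => 0 < ev (L 0) p) ∪ P.filter (fun p => 0 < ev (L M) p) ⊆ P :=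
        Finset.union_subset (Finset.filter_subset _ _) (Finset.filter_subset _ _)
      have hc := Finset.card_sdiff_of_subset hsub
      have hle := Finset.card_le_card hsub
      obtain ⟨q, hq, q', hq', hne⟩ := Finset.one_lt_card.1 (show 1 < (P \
        (P.filter (fun p => 0 < ev (L 0) p) ∪ P.filter (fun p => 0 < ev (L M) p))).card by omega)
      obtain ⟨p, hp⟩ := Finset.card_pos.1 (lt_trans zero_lt_one hcon)
      simp only [Finset.mem_inter, Finset.mem_filter] at hp
      simp only [Finset.mem_sdiff, Finset.mem_union, Finset.mem_filter, not_or, not_and, not_lt]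
        at hq hq'
      have f : ∀ q ∈ P, ev (L 0) q ≤ 0 → ev (L M) q ≤ 0 → q.1 = p.1 := by
        intro q hq a b
        exact hends p hp.1.1 q hq hp.1.2 hp.2.2 (lt_of_le_of_ne a ((hhalf 0 (by omega)).1 q hq))
          (lt_of_le_of_ne b ((hhalf M le_rfl).1 q hq))
      refine coll_vert P hP q q' p hq.1 hq'.1 hp.1.1 hne ?_ ?_
        (f q hq.1 (hq.2.1 hq.1) (hq.2.2 hq.1)) (f q' hq'.1 (hq'.2.1 hq'.1) (hq'.2.2 hq'.1))
      · rintro rfl; linarith [hq.2.1 hq.1, hp.1.2]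
      · rintro rfl; linarith [hq'.2.1 hq'.1, hp.1.2]
    have := Finset.card_sdiff_add_card_inter (P.filter (fun p => 0 < ev (L 0) p))
      (P.filter (fun p => 0 < ev (L M) p))
    rw [(hhalf 0 (by omega)).2.1] at this
    omega


lemma min_seg (A B : Finset Pt) (x0 : ℝ) (hA : A.Nonempty) (hB : B.Nonempty)
    (hAx : ∀ p ∈ A, x0 < p.1) (hBx : ∀ q ∈ B, q.1 < x0) :
    ∃ p ∈ A, ∃ q ∈ B, ∃ L : ℝ × ℝ, ev L p = 0 ∧ ev L q = 0 ∧ (∀ z ∈ A, 0 ≤ ev L z) ∧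
      (∀ z ∈ B, 0 ≤ ev L z) := by
  let Ln : Pt × Pt → ℝ × ℝ := fun z => ((z.1.2 - z.2.2) / (z.1.1 - z.2.1),
    z.1.2 - (z.1.2 - z.2.2) / (z.1.1 - z.2.1) * z.1.1)
  have hLn1 : ∀ p q : Pt, ev (Ln (p, q)) p = 0 := by
    intro p q; simp only [ev, Ln]; ring
  have hLn2 : ∀ p ∈ A, ∀ q ∈ B, ev (Ln (p, q)) q = 0 := by
    intro p hp q hq
    have : p.1 - q.1 ≠ 0 := by have := hAx p hp; have := hBx q hq; intro h; linarith
    simp only [ev, Ln]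
    field_simp
    ring
  obtain ⟨⟨p, q⟩, hpq, hmin⟩ := Finset.exists_min_image (A ×ˢ B)
    (fun z => (Ln z).1 * x0 + (Ln z).2) (hA.product hB)
  rw [Finset.mem_product] at hpq
  obtain ⟨hp, hq⟩ := hpq
  simp only at hp hq
  have e1 := hLn1 p q
  have e2 := hLn2 p hp q hq
  refine ⟨p, hp, q, hq, Ln (p, q), e1, e2, ?_, ?_⟩
  · intro z hz
    by_contra hcon
    push Not at hcon
    have f1 := hLn1 z q
    have f2 := hLn2 z hz q hq
    have hm := hmin (z, q) (Finset.mem_product.2 ⟨hz, hq⟩)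
    generalize Ln (p, q) = L at *
    generalize Ln (z, q) = L' at *
    simp only [ev] at *
    have hs : L'.1 < L.1 := by
      by_contra h; push Not at h
      nlinarith [mul_nonneg (sub_nonneg.2 h) (sub_nonneg.2 ((hBx q hq).trans (hAx z hz)).le)]
    nlinarith [mul_pos (sub_pos.2 hs) (sub_pos.2 (hBx q hq))]
  · intro z hz
    by_contra hcon
    push Not at hcon
    have f1 := hLn1 p z
    have f2 := hLn2 p hp z hz
    have hm := hmin (p, z) (Finset.mem_product.2 ⟨hp, hz⟩)
    generalize Ln (p, q) = L at *
    generalize Ln (p, z) = L' at *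
    simp only [ev] at *
    have hs : L.1 < L'.1 := by
      by_contra h; push Not at h
      nlinarith [mul_nonneg (sub_nonneg.2 h) (sub_nonneg.2 ((hBx z hz).trans (hAx p hp)).le)]
    nlinarith [mul_pos (sub_pos.2 hs) (sub_pos.2 (hAx p hp))]

lemma max_seg (A B : Finset Pt) (x0 : ℝ) (hA : A.Nonempty) (hB : B.Nonempty)
    (hAx : ∀ p ∈ A, x0 < p.1) (hBx : ∀ q ∈ B, q.1 < x0) :
    ∃ p ∈ A, ∃ q ∈ B, ∃ L : ℝ × ℝ, ev L p = 0 ∧ ev L q = 0 ∧ (∀ z ∈ A, ev L z ≤ 0) ∧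
      (∀ z ∈ B, ev L z ≤ 0) := by
  let ρ : Pt → Pt := fun z => (z.1, - z.2)
  obtain ⟨p, hp, q, hq, L, h1, h2, h3, h4⟩ := min_seg (A.image ρ) (B.image ρ) x0 (hA.image _)
    (hB.image _) (by
      intro p hp
      obtain ⟨z, hz, rfl⟩ := Finset.mem_image.1 hp
      exact hAx z hz) (by
      intro p hp
      obtain ⟨z, hz, rfl⟩ := Finset.mem_image.1 hp
      exact hBx z hz)
  obtain ⟨p', hp', rfl⟩ := Finset.mem_image.1 hp
  obtain ⟨q', hq', rfl⟩ := Finset.mem_image.1 hq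
  have hev : ∀ z, ev (-L.1, -L.2) z = - ev L (ρ z) := by
    intro z; simp only [ev, ρ]; ring
  refine ⟨p', hp', q', hq', (-L.1, -L.2), ?_, ?_, ?_, ?_⟩
  · rw [hev, h1, neg_zero]
  · rw [hev, h2, neg_zero]
  · intro z hz
    rw [hev]; linarith [h3 _ (Finset.mem_image_of_mem ρ hz)]
  · intro z hz
    rw [hev]; linarith [h4 _ (Finset.mem_image_of_mem ρ hz)]

lemma median (X : Finset Pt) (f : Pt → ℝ) (m : ℕ) (hm : 0 < m) (hX : 2 * m ≤ X.card) :
    ∃ τ, m ≤ (X.filter (fun p => τ ≤ f p)).card ∧ m ≤ (X.filter (fun p => f p ≤ τ)).card := by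
  have hXne : X.Nonempty := Finset.card_pos.1 (by omega)
  have hne : (X.filter (fun v => m ≤ (X.filter (fun p => f v ≤ f p)).card)).Nonempty := by
    obtain ⟨v, hv, hmin⟩ := Finset.exists_min_image X f hXne
    refine ⟨v, Finset.mem_filter.2 ⟨hv, ?_⟩⟩
    rw [Finset.filter_true_of_mem hmin]
    omega
  obtain ⟨v, hv, hmax⟩ := Finset.exists_max_image _ f hne
  rw [Finset.mem_filter] at hv
  refine ⟨f v, hv.2, ?_⟩
  by_contra hcon
  push Not at hcon
  have h2 := Finset.card_filter_add_card_filter_not (s := X) (fun p => f p ≤ f v)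
  have hc : m < (X.filter (fun p => ¬ f p ≤ f v)).card := by omega
  obtain ⟨u, hu, humin⟩ := Finset.exists_min_image (X.filter (fun p => ¬ f p ≤ f v)) f
    (Finset.card_pos.1 (by omega))
  rw [Finset.mem_filter] at hu
  have := hmax u (Finset.mem_filter.2 ⟨hu.1, ?_⟩)
  · exact hu.2 this
  · refine hc.le.trans (Finset.card_le_card ?_)
    intro p hp
    exact Finset.mem_filter.2 ⟨(Finset.mem_filter.1 hp).1, humin p hp⟩

lemma match_one (P : Finset Pt) (hP : GenPos P) (m w : ℕ) (hm : 0 < m)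
    (hN : ¬ NonCrossingFamily P m) (hbig : 2 * m + 2 * w + 2 ≤ P.card)
    (k l : ℝ × ℝ) (hkl : k.1 < l.1) (hk : NH P 1 k) (hl : NH P 1 l)
    (hk0 : ∀ p ∈ P, ev k p ≠ 0) (hl0 : ∀ p ∈ P, ev l p ≠ 0)
    (hWp : (P.filter (fun p => 0 < ev k p ∧ ev l p < 0)).card = w)
    (hWm : (P.filter (fun p => ev k p < 0 ∧ 0 < ev l p)).card = w)
    (X Y : Finset Pt) (hX : ∀ p ∈ X, p ∈ P ∧ 0 < ev k p ∧ ev l p < 0)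
    (hY : ∀ p ∈ Y, p ∈ P ∧ ev k p < 0 ∧ 0 < ev l p)
    (cX : 2 * m ≤ X.card) (cY : 2 * m ≤ Y.card) :
    ∃ p ∈ X, ∃ q ∈ Y, ∃ L : ℝ × ℝ, ev L p = 0 ∧ ev L q = 0 ∧ k.1 < L.1 ∧ L.1 < l.1 ∧
      NH P (w + m + 1) L := by
  obtain ⟨x0, y0, a1, a2⟩ : ∃ x0 y0 : ℝ, y0 = k.1 * x0 + k.2 ∧ y0 = l.1 * x0 + l.2 := by
    refine ⟨(k.2 - l.2) / (l.1 - k.1), _, rfl, ?_⟩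
    have : l.1 - k.1 ≠ 0 := by intro h; linarith
    field_simp
    ring
  have Xx : ∀ p ∈ X, x0 < p.1 := by
    intro p hp
    obtain ⟨-, h1, h2⟩ := hX p hp
    simp only [ev] at h1 h2
    by_contra h; push Not at h
    nlinarith [mul_nonneg (sub_nonneg.2 hkl.le) (sub_nonneg.2 h)]
  have Yx : ∀ p ∈ Y, p.1 < x0 := by
    intro p hp
    obtain ⟨-, h1, h2⟩ := hY p hp
    simp only [ev] at h1 h2
    by_contra h; push Not at h
    nlinarith [mul_nonneg (sub_nonneg.2 hkl.le) (sub_nonneg.2 h)]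
  -- the two double wedges
  set Sp := P.filter (fun p => 0 < ev k p ∧ 0 < ev l p) with hSp
  set Sm := P.filter (fun p => ev k p < 0 ∧ ev l p < 0) with hSm
  have cSp : P.card ≤ 2 * Sp.card + 2 * w + 2 := by
    have : P.filter (fun p => 0 < ev k p) ⊆ Sp ∪ P.filter (fun p => 0 < ev k p ∧ ev l p < 0) := by
      intro p hp
      rw [Finset.mem_filter] at hp
      rcases lt_or_gt_of_ne (hl0 p hp.1) with h | h
      · exact Finset.mem_union_right _ (Finset.mem_filter.2 ⟨hp.1, hp.2, h⟩)
      · exact Finset.mem_union_left _ (Finset.mem_filter.2 ⟨hp.1, hp.2, h⟩)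
    have h1 := (Finset.card_le_card this).trans (Finset.card_union_le _ _)
    have := hk.1
    omega
  have cSm : P.card ≤ 2 * Sm.card + 2 * w + 2 := by
    have : P.filter (fun p => ev k p < 0) ⊆ Sm ∪ P.filter (fun p => ev k p < 0 ∧ 0 < ev l p) := by
      intro p hp
      rw [Finset.mem_filter] at hp
      rcases lt_or_gt_of_ne (hl0 p hp.1) with h | h
      · exact Finset.mem_union_left _ (Finset.mem_filter.2 ⟨hp.1, hp.2, h⟩)
      · exact Finset.mem_union_right _ (Finset.mem_filter.2 ⟨hp.1, hp.2, h⟩)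
    have h1 := (Finset.card_le_card this).trans (Finset.card_union_le _ _)
    have := hk.2
    omega
  have slopes : ∀ p ∈ X, ∀ q ∈ Y, ∀ L : ℝ × ℝ, ev L p = 0 → ev L q = 0 → k.1 < L.1 ∧ L.1 < l.1 := by
    intro p hp q hq L h1 h2
    obtain ⟨-, p1, p2⟩ := hX p hp
    obtain ⟨-, q1, q2⟩ := hY q hq
    have hx := (Yx q hq).trans (Xx p hp)
    simp only [ev] at *
    constructor
    · by_contra h; push Not at h
      nlinarith [mul_nonneg (sub_nonneg.2 h) (sub_nonneg.2 hx.le)]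
    · by_contra h; push Not at h
      nlinarith [mul_nonneg (sub_nonneg.2 h) (sub_nonneg.2 hx.le)]
  have offline : ∀ p ∈ X, ∀ q ∈ Y, ∀ L : ℝ × ℝ, ev L p = 0 → ev L q = 0 → ∀ z ∈ P,
      0 < ev k z * ev l z → ev L z ≠ 0 := by
    intro p hp q hq L h1 h2 z hz hzS h3
    obtain ⟨pP, p1, p2⟩ := hX p hp
    obtain ⟨qP, q1, q2⟩ := hY q hq
    have hx := (Yx q hq).trans (Xx p hp)
    refine coll_slope P hP L.1 p q z pP qP hz ?_ ?_ ?_ ?_ ?_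
    · rintro rfl; exact lt_irrefl _ hx
    · rintro rfl; nlinarith [mul_pos p1 (neg_pos.2 p2)]
    · rintro rfl; nlinarith [mul_pos q2 (neg_pos.2 q1)]
    · simp only [ev] at h1 h3; linarith
    · simp only [ev] at h2 h3; linarith
  have up : ∀ A ⊆ X, ∀ B ⊆ Y, m ≤ A.card → m ≤ B.card → ∀ τ : ℝ,
      (∀ z ∈ A, 0 ≤ z.2 - y0 - τ * (z.1 - x0)) → (∀ z ∈ B, 0 ≤ z.2 - y0 - τ * (z.1 - x0)) →
      ∃ p ∈ X, ∃ q ∈ Y, ∃ L : ℝ × ℝ, ev L p = 0 ∧ ev L q = 0 ∧ k.1 < L.1 ∧ L.1 < l.1 ∧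
      NH P (w + m + 1) L := by
    intro A hA B hB cA cB τ tA tB
    obtain ⟨p, hp, q, hq, L, Lp, Lq, LA, LB⟩ := min_seg A B x0 (Finset.card_pos.1 (by omega))
      (Finset.card_pos.1 (by omega)) (fun p hp => Xx p (hA hp)) (fun p hp => Yx p (hB hp))
    obtain ⟨s1, s2⟩ := slopes p (hA hp) q (hB hq) L Lp Lq
    have off := offline p (hA hp) q (hB hq) L Lp Lq
    refine ⟨p, hA hp, q, hB hq, L, Lp, Lq, s1, s2, ?_⟩
    have hh : y0 ≤ L.1 * x0 + L.2 := by
      have t1 := tA p hp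
      have t2 := tB q hq
      have x1 := Xx p (hA hp)
      have x2 := Yx q (hB hq)
      simp only [ev] at Lp Lq
      rcases le_total τ L.1 with h | h
      · nlinarith [mul_nonneg (sub_nonneg.2 h) (sub_nonneg.2 x2.le)]
      · nlinarith [mul_nonneg (sub_nonneg.2 h) (sub_nonneg.2 x1.le)]
    have below : ∀ z ∈ Sm, ev L z < 0 := by
      intro z hz
      rw [hSm, Finset.mem_filter] at hz
      obtain ⟨-, z1, z2⟩ := hz
      simp only [ev] at *
      rcases le_total x0 z.1 with h | h
      · nlinarith [mul_nonneg (sub_nonneg.2 s1.le) (sub_nonneg.2 h)]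
      · nlinarith [mul_nonneg (sub_nonneg.2 s2.le) (sub_nonneg.2 h)]
    have hD : (Sp.filter (fun z => ev L z < 0)).card < m := by
      by_contra hcon
      push Not at hcon
      apply hN
      refine ncf_of_cr P m hm B A Sm (Sp.filter (fun z => ev L z < 0))
        (fun z hz => (hY z (hB hz)).1) (fun z hz => (hX z (hA hz)).1) (Finset.filter_subset _ _)
        ((Finset.filter_subset _ _).trans (Finset.filter_subset _ _)) cB cA (by omega) hcon ?_
      intro v1 h1 v2 h2 v3 h3 t ht
      rw [Finset.mem_filter, hSp, Finset.mem_filter] at ht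
      rw [hSm, Finset.mem_filter] at h3
      obtain ⟨⟨-, t1, t2⟩, t3⟩ := ht
      obtain ⟨-, u1, u2⟩ := h3
      obtain ⟨-, b1, b2⟩ := hY v1 (hB h1)
      obtain ⟨-, c1, c2⟩ := hX v2 (hA h2)
      have d1 := LB v1 h1
      have d2 := LA v2 h2
      simp only [ev] at t1 t2 t3 u1 u2 b1 b2 c1 c2 d1 d2
      apply dir_cr' k.1 L.1 l.1 v1 v2 v3 t s1.le s2.le <;> linarith
    have f1 : Sp ⊆ Sp.filter (fun z => ev L z < 0) ∪ P.filter (fun z => 0 < ev L z) := by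
      intro z hz
      have hz' := hz
      rw [hSp, Finset.mem_filter] at hz'
      rcases lt_or_gt_of_ne (off z hz'.1 (mul_pos hz'.2.1 hz'.2.2)) with h | h
      · exact Finset.mem_union_left _ (Finset.mem_filter.2 ⟨hz, h⟩)
      · exact Finset.mem_union_right _ (Finset.mem_filter.2 ⟨hz'.1, h⟩)
    have f2 : Sm ⊆ P.filter (fun z => ev L z < 0) := fun z hz =>
      Finset.mem_filter.2 ⟨(Finset.mem_filter.1 hz).1, below z hz⟩
    have g1 := (Finset.card_le_card f1).trans (Finset.card_union_le _ _)
    have g2 := Finset.card_le_card f2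
    constructor <;> omega
  have down : ∀ A ⊆ X, ∀ B ⊆ Y, m ≤ A.card → m ≤ B.card → ∀ τ : ℝ,
      (∀ z ∈ A, z.2 - y0 - τ * (z.1 - x0) ≤ 0) → (∀ z ∈ B, z.2 - y0 - τ * (z.1 - x0) ≤ 0) →
      ∃ p ∈ X, ∃ q ∈ Y, ∃ L : ℝ × ℝ, ev L p = 0 ∧ ev L q = 0 ∧ k.1 < L.1 ∧ L.1 < l.1 ∧
      NH P (w + m + 1) L := by
    intro A hA B hB cA cB τ tA tB
    obtain ⟨p, hp, q, hq, L, Lp, Lq, LA, LB⟩ := max_seg A B x0 (Finset.card_pos.1 (by omega))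
      (Finset.card_pos.1 (by omega)) (fun p hp => Xx p (hA hp)) (fun p hp => Yx p (hB hp))
    obtain ⟨s1, s2⟩ := slopes p (hA hp) q (hB hq) L Lp Lq
    have off := offline p (hA hp) q (hB hq) L Lp Lq
    refine ⟨p, hA hp, q, hB hq, L, Lp, Lq, s1, s2, ?_⟩
    have hh : L.1 * x0 + L.2 ≤ y0 := by
      have t1 := tA p hp
      have t2 := tB q hq
      have x1 := Xx p (hA hp)
      have x2 := Yx q (hB hq)
      simp only [ev] at Lp Lq
      rcases le_total τ L.1 with h | h
      · nlinarith [mul_nonneg (sub_nonneg.2 h) (sub_nonneg.2 x1.le)]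
      · nlinarith [mul_nonneg (sub_nonneg.2 h) (sub_nonneg.2 x2.le)]
    have above : ∀ z ∈ Sp, 0 < ev L z := by
      intro z hz
      rw [hSp, Finset.mem_filter] at hz
      obtain ⟨-, z1, z2⟩ := hz
      simp only [ev] at *
      rcases le_total x0 z.1 with h | h
      · nlinarith [mul_nonneg (sub_nonneg.2 s2.le) (sub_nonneg.2 h)]
      · nlinarith [mul_nonneg (sub_nonneg.2 s1.le) (sub_nonneg.2 h)]
    have hD : (Sm.filter (fun z => 0 < ev L z)).card < m := by
      by_contra hcon
      push Not at hcon
      apply hN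
      refine ncf_of_cr P m hm A B Sp (Sm.filter (fun z => 0 < ev L z))
        (fun z hz => (hX z (hA hz)).1) (fun z hz => (hY z (hB hz)).1) (Finset.filter_subset _ _)
        ((Finset.filter_subset _ _).trans (Finset.filter_subset _ _)) cA cB (by omega) hcon ?_
      intro v1 h1 v2 h2 v3 h3 t ht
      rw [Finset.mem_filter, hSm, Finset.mem_filter] at ht
      rw [hSp, Finset.mem_filter] at h3
      obtain ⟨⟨-, t1, t2⟩, t3⟩ := ht
      obtain ⟨-, u1, u2⟩ := h3
      obtain ⟨-, b1, b2⟩ := hX v1 (hA h1)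
      obtain ⟨-, c1, c2⟩ := hY v2 (hB h2)
      have d1 := LA v1 h1
      have d2 := LB v2 h2
      simp only [ev] at t1 t2 t3 u1 u2 b1 b2 c1 c2 d1 d2
      apply dir_cr k.1 L.1 l.1 v1 v2 v3 t s1.le s2.le <;> linarith
    have f1 : Sm ⊆ Sm.filter (fun z => 0 < ev L z) ∪ P.filter (fun z => ev L z < 0) := by
      intro z hz
      have hz' := hz
      rw [hSm, Finset.mem_filter] at hz'
      rcases lt_or_gt_of_ne (off z hz'.1 (mul_pos_of_neg_of_neg hz'.2.1 hz'.2.2)) with h | h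
      · exact Finset.mem_union_right _ (Finset.mem_filter.2 ⟨hz'.1, h⟩)
      · exact Finset.mem_union_left _ (Finset.mem_filter.2 ⟨hz, h⟩)
    have f2 : Sp ⊆ P.filter (fun z => 0 < ev L z) := fun z hz =>
      Finset.mem_filter.2 ⟨(Finset.mem_filter.1 hz).1, above z hz⟩
    have g1 := (Finset.card_le_card f1).trans (Finset.card_union_le _ _)
    have g2 := Finset.card_le_card f2
    constructor <;> omega
  obtain ⟨τ, m1, m2⟩ := median X (fun z => (z.2 - y0) / (z.1 - x0)) m hm cX
  have cc : (Y.filter (fun z => (z.2 - y0) / (z.1 - x0) ≤ τ)).card +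
      (Y.filter (fun z => ¬ (z.2 - y0) / (z.1 - x0) ≤ τ)).card = Y.card :=
    Finset.card_filter_add_card_filter_not _
  rcases le_or_gt m (Y.filter (fun z => (z.2 - y0) / (z.1 - x0) ≤ τ)).card with h | h
  · refine up _ (Finset.filter_subset _ _) _ (Finset.filter_subset _ _) m1 h τ ?_ ?_
    · intro z hz
      rw [Finset.mem_filter] at hz
      have hx := Xx z hz.1
      have := (le_div_iff₀ (by linarith)).1 hz.2
      linarith
    · intro z hz
      rw [Finset.mem_filter] at hz
      have hx := Yx z hz.1
      have := (div_le_iff_of_neg (by linarith)).1 hz.2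
      linarith
  · refine down _ (Finset.filter_subset _ _) _ (Finset.filter_subset _ _) m2
      (by omega : m ≤ (Y.filter (fun z => ¬ (z.2 - y0) / (z.1 - x0) ≤ τ)).card) τ ?_ ?_
    · intro z hz
      rw [Finset.mem_filter] at hz
      have hx := Xx z hz.1
      have := (div_le_iff₀ (by linarith)).1 hz.2
      linarith
    · intro z hz
      rw [Finset.mem_filter, not_le] at hz
      have hx := Yx z hz.1
      have := (lt_div_iff_of_neg (by linarith)).1 hz.2
      linarith

lemma peel (U V : Finset Pt) (m : ℕ) (Good : Pt → Pt → Prop)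
    (hG : ∀ X ⊆ U, ∀ Y ⊆ V, 2 * m ≤ X.card → 2 * m ≤ Y.card → ∃ p ∈ X, ∃ q ∈ Y, Good p q) :
    ∃ Mt : Finset (Pt × Pt), (∀ z ∈ Mt, z.1 ∈ U ∧ z.2 ∈ V ∧ Good z.1 z.2) ∧
      Set.InjOn Prod.fst (Mt : Set (Pt × Pt)) ∧ Set.InjOn Prod.snd (Mt : Set (Pt × Pt)) ∧
      min U.card V.card ≤ Mt.card + 2 * m := by
  have key : ∀ k, (k = 0 ∨ (k + 2 * m ≤ U.card ∧ k + 2 * m ≤ V.card)) →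
      ∃ Mt : Finset (Pt × Pt), (∀ z ∈ Mt, z.1 ∈ U ∧ z.2 ∈ V ∧ Good z.1 z.2) ∧
      Set.InjOn Prod.fst (Mt : Set (Pt × Pt)) ∧ Set.InjOn Prod.snd (Mt : Set (Pt × Pt)) ∧
      Mt.card = k := by
    intro k
    induction k with
    | zero => intro _; exact ⟨∅, by simp, by simp, by simp, by simp⟩
    | succ k ih =>
      intro hk
      obtain ⟨Mt, h1, h2, h3, h4⟩ := ih (by omega)
      have cU : 2 * m ≤ (U \ Mt.image Prod.fst).card := by
        have a := Finset.le_card_sdiff (Mt.image Prod.fst) U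
        have b : (Mt.image Prod.fst).card ≤ Mt.card := Finset.card_image_le
        omega
      have cV : 2 * m ≤ (V \ Mt.image Prod.snd).card := by
        have a := Finset.le_card_sdiff (Mt.image Prod.snd) V
        have b : (Mt.image Prod.snd).card ≤ Mt.card := Finset.card_image_le
        omega
      obtain ⟨p, hp, q, hq, hg⟩ := hG _ Finset.sdiff_subset _ Finset.sdiff_subset cU cV
      rw [Finset.mem_sdiff] at hp hq
      have hnot : (p, q) ∉ Mt := fun h => hp.2 (Finset.mem_image_of_mem Prod.fst h)
      refine ⟨insert (p, q) Mt, ?_, ?_, ?_, ?_⟩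
      · intro z hz
        rcases Finset.mem_insert.1 hz with rfl | hz
        · exact ⟨hp.1, hq.1, hg⟩
        · exact h1 z hz
      · rw [Finset.coe_insert, Set.injOn_insert (by simpa using hnot)]
        refine ⟨h2, ?_⟩
        rintro ⟨z, hz, e⟩
        exact hp.2 (Finset.mem_image.2 ⟨z, hz, e⟩)
      · rw [Finset.coe_insert, Set.injOn_insert (by simpa using hnot)]
        refine ⟨h3, ?_⟩
        rintro ⟨z, hz, e⟩
        exact hq.2 (Finset.mem_image.2 ⟨z, hz, e⟩)
      · rw [Finset.card_insert_of_notMem hnot, h4]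
  obtain ⟨Mt, h1, h2, h3, h4⟩ := key (min U.card V.card - 2 * m) (by omega)
  exact ⟨Mt, h1, h2, h3, by omega⟩


lemma zoneB {β δ : Type} (P : Finset Pt) (m e : ℕ) (hm : 0 < m) (hN : ¬ NonCrossingFamily P m)
    (ℓ : β → ℝ × ℝ) (hNH : ∀ b, NH P e (ℓ b))
    (R : Finset β) (Γ : Finset δ) (g : δ → ℝ) (lo hi : δ → β)
    (H1 : ∀ γ ∈ Γ, (ℓ (lo γ)).1 < g γ ∧ g γ < (ℓ (hi γ)).1)
    (H2 : ∀ L ∈ R, ∀ γ ∈ Γ, (ℓ L).1 ≤ (ℓ (lo γ)).1 ∨ (ℓ (hi γ)).1 ≤ (ℓ L).1)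
    (H3 : ∀ γ ∈ Γ, ∀ γ' ∈ Γ, γ ≠ γ' →
      ∃ L ∈ R, (g γ < (ℓ L).1 ∧ (ℓ L).1 < g γ') ∨ (g γ' < (ℓ L).1 ∧ (ℓ L).1 < g γ)) :
    ∃ BR BL : δ → Finset Pt,
      (∀ γ, ∀ p ∈ P, 0 ≤ ev (ℓ (lo γ)) p → ev (ℓ (hi γ)) p ≤ 0 →
        ((∃ L ∈ R, (ℓ L).1 < g γ ∧ ev (ℓ L) p ≤ 0) ∨
        (∃ L ∈ R, g γ < (ℓ L).1 ∧ 0 ≤ ev (ℓ L) p)) → p ∈ BR γ) ∧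
      (∀ γ, ∀ p ∈ P, ev (ℓ (lo γ)) p ≤ 0 → 0 ≤ ev (ℓ (hi γ)) p →
        ((∃ L ∈ R, (ℓ L).1 < g γ ∧ 0 ≤ ev (ℓ L) p) ∨
        (∃ L ∈ R, g γ < (ℓ L).1 ∧ ev (ℓ L) p ≤ 0)) → p ∈ BL γ) ∧
      ∑ γ ∈ Γ, (BR γ).card ≤ 2 * ((2 * Γ.card + R.card) * (m + 2 * e)) ∧
      ∑ γ ∈ Γ, (BL γ).card ≤ 2 * ((2 * Γ.card + R.card) * (m + 2 * e)) := by
  obtain ⟨h1, h2⟩ := zoneP P m e hm hN ℓ hNH R Γ g lo hi H1 H2 H3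
  exact ⟨_, _, fun γ p hp a b c => Finset.mem_filter.2 ⟨hp, a, b, c⟩,
    fun γ p hp a b c => Finset.mem_filter.2 ⟨hp, a, b, c⟩, h1, h2⟩

/-- A system of matched pairs, tagged by the double wedge they live in. -/
structure Sys (P : Finset Pt) (K w e : ℕ) (ℓ : ℕ → ℝ × ℝ) (M : Finset (ℕ × (Pt × Pt)))
    (Ln : ℕ × (Pt × Pt) → ℝ × ℝ) : Prop where
  mono : ∀ i j, i < j → j ≤ K → (ℓ i).1 < (ℓ j).1
  nhl : ∀ i, NH P 1 (ℓ i)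
  tag : ∀ z ∈ M, z.1 < K
  pmem : ∀ z ∈ M, z.2.1 ∈ P
  qmem : ∀ z ∈ M, z.2.2 ∈ P
  pl : ∀ z ∈ M, ∀ j, j ≤ z.1 → 0 < ev (ℓ j) z.2.1 ∧ ev (ℓ j) z.2.2 < 0
  pu : ∀ z ∈ M, ∀ j, z.1 < j → j ≤ K → ev (ℓ j) z.2.1 < 0 ∧ 0 < ev (ℓ j) z.2.2
  on : ∀ z ∈ M, ev (Ln z) z.2.1 = 0 ∧ ev (Ln z) z.2.2 = 0
  sl : ∀ z ∈ M, (ℓ z.1).1 < (Ln z).1 ∧ (Ln z).1 < (ℓ (z.1 + 1)).1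
  nh : ∀ z ∈ M, NH P e (Ln z)
  inj1 : ∀ z ∈ M, ∀ z' ∈ M, z.2.1 = z'.2.1 → z = z'
  inj2 : ∀ z ∈ M, ∀ z' ∈ M, z.2.2 = z'.2.2 → z = z'
  fib : ∀ i, (M.filter (fun z => z.1 = i)).card ≤ w

lemma exists_sys (P : Finset Pt) (m w K : ℕ) (hm : 0 < m) (hP : GenPos P)
    (hN : ¬ NonCrossingFamily P m) (hbig : 2 * m + 2 * w + 2 ≤ P.card) (ℓ : ℕ → ℝ × ℝ)
    (hmono : ∀ i j, i < j → j ≤ K → (ℓ i).1 < (ℓ j).1)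
    (hz : ∀ i ≤ K, (∀ p ∈ P, ev (ℓ i) p ≠ 0)) (hNH : ∀ i, NH P 1 (ℓ i))
    (hWp : ∀ i < K, (P.filter (fun p => 0 < ev (ℓ i) p ∧ ev (ℓ (i + 1)) p < 0)).card = w)
    (hWm : ∀ i < K, (P.filter (fun p => ev (ℓ i) p < 0 ∧ 0 < ev (ℓ (i + 1)) p)).card = w) :
    ∃ M Ln, Sys P K w (w + m + 1) ℓ M Ln ∧
      K * w ≤ M.card + 2 * K * m + 4 * ((3 * K + 1) * (m + 2)) := by
  have wmono : ∀ i j, i ≤ j → j ≤ K → (ℓ i).1 ≤ (ℓ j).1 := by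
    intro i j hij hj
    rcases hij.eq_or_lt with rfl | h
    · exact le_rfl
    · exact (hmono i j h hj).le
  have hg : ∀ i < K, (ℓ i).1 < ((ℓ i).1 + (ℓ (i + 1)).1) / 2 ∧
      ((ℓ i).1 + (ℓ (i + 1)).1) / 2 < (ℓ (i + 1)).1 := by
    intro i hi
    have := hmono i (i + 1) (by omega) (by omega)
    constructor <;> linarith
  obtain ⟨BR, BL, hBR, hBL, cBR, cBL⟩ := zoneB P m 1 hm hN ℓ hNH (Finset.range (K + 1))
    (Finset.range K) (fun i => ((ℓ i).1 + (ℓ (i + 1)).1) / 2) (fun i => i) (fun i => i + 1)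
    (fun i hi => hg i (Finset.mem_range.1 hi))
    (by
      intro L hL i hi
      rw [Finset.mem_range] at hL hi
      rcases Nat.lt_or_ge i L with h | h
      · exact Or.inr (wmono _ _ h (by omega))
      · exact Or.inl (wmono _ _ h (by omega)))
    (by
      have aux : ∀ i j, i < j → j < K → ((ℓ i).1 + (ℓ (i + 1)).1) / 2 < (ℓ (i + 1)).1 ∧
          (ℓ (i + 1)).1 < ((ℓ j).1 + (ℓ (j + 1)).1) / 2 := by
        intro i j hij hj
        have h1 := hg i (by omega)
        have h2 := hg j hj
        have h3 := wmono (i + 1) j hij (by omega)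
        exact ⟨h1.2, by linarith [h2.1]⟩
      intro i hi j hj hne
      rw [Finset.mem_range] at hi hj
      rcases Nat.lt_or_gt_of_ne hne with h | h
      · exact ⟨i + 1, Finset.mem_range.2 (by omega), Or.inl (aux i j h hj)⟩
      · exact ⟨j + 1, Finset.mem_range.2 (by omega), Or.inr (aux j i h hi)⟩)
  rw [Finset.card_range, Finset.card_range] at cBR cBL
  -- points in the right/left unbounded cells
  obtain ⟨Up, hUp⟩ : ∃ Up : ℕ → Finset Pt, ∀ i p, p ∈ Up i ↔ p ∈ P ∧ (∀ j ≤ i, 0 < ev (ℓ j) p) ∧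
      ∀ j, i < j → j ≤ K → ev (ℓ j) p < 0 := ⟨fun i => P.filter (fun p => (∀ j ≤ i, 0 < ev (ℓ j) p) ∧
      ∀ j, i < j → j ≤ K → ev (ℓ j) p < 0), fun i p => Finset.mem_filter⟩
  obtain ⟨Um, hUm⟩ : ∃ Um : ℕ → Finset Pt, ∀ i p, p ∈ Um i ↔ p ∈ P ∧ (∀ j ≤ i, ev (ℓ j) p < 0) ∧
      ∀ j, i < j → j ≤ K → 0 < ev (ℓ j) p := ⟨fun i => P.filter (fun p => (∀ j ≤ i, ev (ℓ j) p < 0) ∧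
      ∀ j, i < j → j ≤ K → 0 < ev (ℓ j) p), fun i p => Finset.mem_filter⟩
  have cUp : ∀ i < K, w ≤ (Up i).card + (BR i).card := by
    intro i hi
    rw [← hWp i hi]
    refine (Finset.card_le_card ?_).trans (Finset.card_union_le _ _)
    intro p hp
    rw [Finset.mem_filter] at hp
    obtain ⟨pP, p1, p2⟩ := hp
    rw [Finset.mem_union]
    by_contra hcon
    push Not at hcon
    obtain ⟨n1, n2⟩ := hcon
    apply n1
    rw [hUp]
    refine ⟨pP, fun j hj => ?_, fun j hj hjK => ?_⟩
    · by_contra h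
      push Not at h
      refine n2 (hBR i p pP p1.le p2.le (Or.inl ⟨j, Finset.mem_range.2 (by omega), ?_, h⟩))
      linarith [wmono j i hj (by omega), (hg i hi).1]
    · by_contra h
      push Not at h
      refine n2 (hBR i p pP p1.le p2.le (Or.inr ⟨j, Finset.mem_range.2 (by omega), ?_, h⟩))
      linarith [wmono (i + 1) j hj (by omega), (hg i hi).2]
  have cUm : ∀ i < K, w ≤ (Um i).card + (BL i).card := by
    intro i hi
    rw [← hWm i hi]
    refine (Finset.card_le_card ?_).trans (Finset.card_union_le _ _)
    intro p hp
    rw [Finset.mem_filter] at hp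
    obtain ⟨pP, p1, p2⟩ := hp
    rw [Finset.mem_union]
    by_contra hcon
    push Not at hcon
    obtain ⟨n1, n2⟩ := hcon
    apply n1
    rw [hUm]
    refine ⟨pP, fun j hj => ?_, fun j hj hjK => ?_⟩
    · by_contra h
      push Not at h
      refine n2 (hBL i p pP p1.le p2.le (Or.inl ⟨j, Finset.mem_range.2 (by omega), ?_, h⟩))
      linarith [wmono j i hj (by omega), (hg i hi).1]
    · by_contra h
      push Not at h
      refine n2 (hBL i p pP p1.le p2.le (Or.inr ⟨j, Finset.mem_range.2 (by omega), ?_, h⟩))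
      linarith [wmono (i + 1) j hj (by omega), (hg i hi).2]
  -- matchings
  have hmt : ∀ i, ∃ Mt : Finset (Pt × Pt), i < K → ((∀ z ∈ Mt, z.1 ∈ Up i ∧ z.2 ∈ Um i ∧
      ∃ L : ℝ × ℝ, ev L z.1 = 0 ∧ ev L z.2 = 0 ∧ (ℓ i).1 < L.1 ∧ L.1 < (ℓ (i + 1)).1 ∧
      NH P (w + m + 1) L) ∧
      Set.InjOn Prod.fst (Mt : Set (Pt × Pt)) ∧ Set.InjOn Prod.snd (Mt : Set (Pt × Pt)) ∧
      min (Up i).card (Um i).card ≤ Mt.card + 2 * m) := by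
    intro i
    by_cases hi : i < K
    · obtain ⟨Mt, hMt⟩ := peel (Up i) (Um i) m (fun p q => ∃ L : ℝ × ℝ, ev L p = 0 ∧ ev L q = 0 ∧
        (ℓ i).1 < L.1 ∧ L.1 < (ℓ (i + 1)).1 ∧ NH P (w + m + 1) L) (by
          intro X hX Y hY cX cY
          exact match_one P hP m w hm hN hbig (ℓ i) (ℓ (i + 1)) (hmono i (i + 1) (by omega) (by omega))
            (hNH _) (hNH _) (hz i (by omega)) (hz (i + 1) (by omega)) (hWp i hi) (hWm i hi) X Y
            (fun p hp => by
              obtain ⟨a, b, c⟩ := (hUp i p).1 (hX hp)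
              exact ⟨a, b i le_rfl, c (i + 1) (by omega) (by omega)⟩)
            (fun p hp => by
              obtain ⟨a, b, c⟩ := (hUm i p).1 (hY hp)
              exact ⟨a, b i le_rfl, c (i + 1) (by omega) (by omega)⟩) cX cY)
      exact ⟨Mt, fun _ => hMt⟩
    · exact ⟨∅, fun h => absurd h hi⟩
  choose Mt hMt using hmt
  set M : Finset (ℕ × (Pt × Pt)) := (Finset.range K).biUnion
    (fun i => (Mt i).image (fun z => (i, z))) with hM
  have memM : ∀ z, z ∈ M ↔ z.1 < K ∧ z.2 ∈ Mt z.1 := by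
    rintro ⟨i, z⟩
    rw [hM, Finset.mem_biUnion]
    constructor
    · rintro ⟨j, hj, h⟩
      obtain ⟨u, hu, e⟩ := Finset.mem_image.1 h
      obtain ⟨rfl, rfl⟩ := Prod.mk.inj e
      exact ⟨Finset.mem_range.1 hj, hu⟩
    · rintro ⟨h1, h2⟩
      exact ⟨i, Finset.mem_range.2 h1, Finset.mem_image_of_mem _ h2⟩
  have hL : ∀ z, ∃ L : ℝ × ℝ, z ∈ M → ev L z.2.1 = 0 ∧ ev L z.2.2 = 0 ∧ (ℓ z.1).1 < L.1 ∧
      L.1 < (ℓ (z.1 + 1)).1 ∧ NH P (w + m + 1) L := by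
    intro z
    by_cases hzM : z ∈ M
    · obtain ⟨h1, h2⟩ := (memM z).1 hzM
      obtain ⟨-, -, L, hL⟩ := (hMt z.1 h1).1 z.2 h2
      exact ⟨L, fun _ => hL⟩
    · exact ⟨(0, 0), fun h => absurd h hzM⟩
  choose Ln hLn using hL
  have mUp : ∀ z ∈ M, z.2.1 ∈ Up z.1 := fun z h =>
    ((hMt z.1 ((memM z).1 h).1).1 z.2 ((memM z).1 h).2).1
  have mUm : ∀ z ∈ M, z.2.2 ∈ Um z.1 := fun z h =>
    ((hMt z.1 ((memM z).1 h).1).1 z.2 ((memM z).1 h).2).2.1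
  have hinj1 : ∀ z ∈ M, ∀ z' ∈ M, z.2.1 = z'.2.1 → z = z' := by
    have aux : ∀ z ∈ M, ∀ z' ∈ M, z.2.1 = z'.2.1 → ¬ z.1 < z'.1 := by
      intro z hz z' hz' e hlt
      have a := ((hUp _ _).1 (mUp z hz)).2.2 z'.1 hlt ((memM z').1 hz').1.le
      have b := ((hUp _ _).1 (mUp z' hz')).2.1 z'.1 le_rfl
      rw [e] at a
      linarith
    intro z hz z' hz' e
    have ht : z.1 = z'.1 := by
      have := aux z hz z' hz' e
      have := aux z' hz' z hz e.symm
      omega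
    refine Prod.ext ht ?_
    obtain ⟨h1, h2⟩ := (memM z).1 hz
    obtain ⟨h1', h2'⟩ := (memM z').1 hz'
    rw [← ht] at h2'
    exact (hMt z.1 h1).2.1 (Finset.mem_coe.2 h2) (Finset.mem_coe.2 h2') e
  have hinj2 : ∀ z ∈ M, ∀ z' ∈ M, z.2.2 = z'.2.2 → z = z' := by
    have aux : ∀ z ∈ M, ∀ z' ∈ M, z.2.2 = z'.2.2 → ¬ z.1 < z'.1 := by
      intro z hz z' hz' e hlt
      have a := ((hUm _ _).1 (mUm z hz)).2.2 z'.1 hlt ((memM z').1 hz').1.le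
      have b := ((hUm _ _).1 (mUm z' hz')).2.1 z'.1 le_rfl
      rw [e] at a
      linarith
    intro z hz z' hz' e
    have ht : z.1 = z'.1 := by
      have := aux z hz z' hz' e
      have := aux z' hz' z hz e.symm
      omega
    refine Prod.ext ht ?_
    obtain ⟨h1, h2⟩ := (memM z).1 hz
    obtain ⟨h1', h2'⟩ := (memM z').1 hz'
    rw [← ht] at h2'
    exact (hMt z.1 h1).2.2.1 (Finset.mem_coe.2 h2) (Finset.mem_coe.2 h2') e
  refine ⟨M, Ln, ?_, ?_⟩
  · refine ⟨hmono, hNH, fun z h => ((memM z).1 h).1, fun z h => ((hUp _ _).1 (mUp z h)).1,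
      fun z h => ((hUm _ _).1 (mUm z h)).1,
      fun z h j hj => ⟨((hUp _ _).1 (mUp z h)).2.1 j hj, ((hUm _ _).1 (mUm z h)).2.1 j hj⟩,
      fun z h j hj hjK => ⟨((hUp _ _).1 (mUp z h)).2.2 j hj hjK, ((hUm _ _).1 (mUm z h)).2.2 j hj hjK⟩,
      fun z h => ⟨(hLn z h).1, (hLn z h).2.1⟩, fun z h => ⟨(hLn z h).2.2.1, (hLn z h).2.2.2.1⟩,
      fun z h => (hLn z h).2.2.2.2, hinj1, hinj2, ?_⟩
    intro i
    by_cases hi : i < K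
    · rw [← hWp i hi]
      refine Finset.card_le_card_of_injOn (fun z => z.2.1) ?_ ?_
      · intro z hz
        rw [Finset.mem_coe, Finset.mem_filter] at hz
        obtain ⟨h1, rfl⟩ := hz
        obtain ⟨a, b, c⟩ := (hUp _ _).1 (mUp z h1)
        exact Finset.mem_coe.2 (Finset.mem_filter.2 ⟨a, b _ le_rfl, c _ (by omega) (by omega)⟩)
      · intro z hz z' hz' e
        rw [Finset.mem_coe, Finset.mem_filter] at hz hz'
        exact hinj1 z hz.1 z' hz'.1 e
    · rw [Finset.filter_false_of_mem]
      · simp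
      · rintro z hz rfl
        exact hi ((memM z).1 hz).1
  · have hcM : M.card = ∑ i ∈ Finset.range K, (Mt i).card := by
      rw [hM, Finset.card_biUnion]
      · refine Finset.sum_congr rfl fun i _ => ?_
        exact Finset.card_image_of_injective _ (fun a b h => (Prod.mk.inj h).2)
      · intro i _ j _ hij
        rw [Function.onFun, Finset.disjoint_left]
        intro z h1 h2
        obtain ⟨u, -, rfl⟩ := Finset.mem_image.1 h1
        obtain ⟨v, -, e⟩ := Finset.mem_image.1 h2
        exact hij (Prod.mk.inj e).1.symm
    have hsum : ∑ i ∈ Finset.range K, w ≤ ∑ i ∈ Finset.range K,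
        ((Mt i).card + 2 * m + (BR i).card + (BL i).card) := by
      refine Finset.sum_le_sum fun i hi => ?_
      rw [Finset.mem_range] at hi
      have a := cUp i hi
      have b := cUm i hi
      have c := (hMt i hi).2.2.2
      omega
    simp only [Finset.sum_add_distrib, Finset.sum_const, Finset.card_range, smul_eq_mul] at hsum
    rw [← hcM] at hsum
    have e1 : 2 * K + (K + 1) = 3 * K + 1 := by ring
    rw [e1] at cBR cBL
    have e2 : K * (2 * m) = 2 * K * m := by ring
    rw [e2] at hsum
    have e3 : m + 2 * 1 = m + 2 := by ring
    rw [e3] at cBR cBL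
    omega


lemma ev_seg (L : ℝ × ℝ) (p q x : Pt) (hp : ev L p = 0) (hq : ev L q = 0)
    (hx : x ∈ segment ℝ p q) : ev L x = 0 := by
  obtain ⟨a, b, -, -, hab, rfl⟩ := hx
  simp only [ev, Prod.fst_add, Prod.snd_add, Prod.smul_fst, Prod.smul_snd, smul_eq_mul] at *
  have : b = 1 - a := by linarith
  subst this
  linear_combination a * hp + (1 - a) * hq

lemma ev_open (L : ℝ × ℝ) (p q : Pt) (h : ev L p * ev L q < 0) :
    ∃ x ∈ openSegment ℝ p q, ev L x = 0 := by
  have key : ∀ p q : Pt, ev L p < 0 → 0 < ev L q → ∃ x ∈ openSegment ℝ p q, ev L x = 0 := by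
    intro p q h1 h2
    have hd : 0 < ev L q - ev L p := by linarith
    refine ⟨(ev L q / (ev L q - ev L p)) • p + (-ev L p / (ev L q - ev L p)) • q,
      ⟨_, _, div_pos h2 hd, div_pos (by linarith) hd, ?_, rfl⟩, ?_⟩
    · field_simp; ring
    · have e : ∀ a b : ℝ, a + b = 1 → ev L (a • p + b • q) = a * ev L p + b * ev L q := by
        intro a b hab
        simp only [ev, Prod.fst_add, Prod.snd_add, Prod.smul_fst, Prod.smul_snd, smul_eq_mul]
        linear_combination L.2 * hab
      rw [e]
      · field_simp; ring
      · field_simp; ring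
  rcases mul_neg_iff.1 h with ⟨h1, h2⟩ | ⟨h1, h2⟩
  · obtain ⟨x, hx, hx0⟩ := key q p h2 h1
    exact ⟨x, by rwa [openSegment_symm], hx0⟩
  · exact key p q h1 h2

lemma seg_cross (L L' : ℝ × ℝ) (p q p' q' : Pt) (h1 : ev L p = 0) (h2 : ev L q = 0)
    (h3 : ev L' p' = 0) (h4 : ev L' q' = 0) (h5 : ev L' p * ev L' q < 0)
    (h6 : ev L p' * ev L q' < 0) : SegCross (p, q) (p', q') := by
  have hs : L.1 ≠ L'.1 := by
    intro h
    have : ev L' p = ev L' q := by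
      simp only [ev] at *
      rw [← h]; linarith
    rw [this] at h5
    nlinarith [mul_self_nonneg (ev L' q)]
  have uniq : ∀ x y : Pt, ev L x = 0 → ev L' x = 0 → ev L y = 0 → ev L' y = 0 → x = y := by
    intro x y a b c d
    simp only [ev] at a b c d
    have e : (L.1 - L'.1) * (x.1 - y.1) = 0 := by linarith
    have e1 : x.1 = y.1 := by
      rcases mul_eq_zero.1 e with h | h
      · exact absurd (by linarith) hs
      · linarith
    refine Prod.ext e1 ?_
    rw [e1] at a; linarith
  obtain ⟨x, hx, x0⟩ := ev_open L' p q h5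
  obtain ⟨y, hy, y0⟩ := ev_open L p' q' h6
  have x1 := ev_seg L p q x h1 h2 (openSegment_subset_segment _ _ _ hx)
  have y1 := ev_seg L' p' q' y h3 h4 (openSegment_subset_segment _ _ _ hy)
  obtain rfl := uniq x y x1 x0 y0 y1
  refine ⟨x, ?_, hx, hy⟩
  ext z
  constructor
  · rintro ⟨a, b⟩
    exact uniq z x (ev_seg L p q z h1 h2 a) (ev_seg L' p' q' z h3 h4 b) x1 x0
  · rintro rfl
    exact ⟨openSegment_subset_segment _ _ _ hx, openSegment_subset_segment _ _ _ hy⟩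

lemma averaging {α : Type} (M : Finset α) (B : α → α → Prop) (r D : ℕ)
    (h : ∀ R ⊆ M, R.card = r → ((M \ R).filter (fun x => ∃ y ∈ R, B y x)).card ≤ D)
    (hD : 2 * D + r ≤ M.card) (hr : r + 1 ≤ M.card) :
    ∃ S ⊆ M, S.card = r + 1 ∧
      2 * (S.filter (fun x => ∃ y ∈ S, y ≠ x ∧ B y x)).card ≤ r + 1 := by
  by_contra hcon
  push Not at hcon
  set T := (M.powersetCard (r + 1)).sigma
    (fun S => S.filter (fun x => ∃ y ∈ S, y ≠ x ∧ B y x)) with hT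
  set U := (M.powersetCard r).sigma
    (fun R => (M \ R).filter (fun x => ∃ y ∈ R, B y x)) with hU
  have hTU : T.card ≤ U.card := by
    refine Finset.card_le_card_of_injOn (fun z => ⟨z.1.erase z.2, z.2⟩) ?_ ?_
    · rintro ⟨S, x⟩ hz
      rw [Finset.mem_coe, hT, Finset.mem_sigma, Finset.mem_powersetCard, Finset.mem_filter] at hz
      obtain ⟨⟨hS, hc⟩, hx, y, hy, hyx, hB⟩ := hz
      rw [Finset.mem_coe, hU, Finset.mem_sigma, Finset.mem_powersetCard, Finset.mem_filter]
      refine ⟨⟨(Finset.erase_subset _ _).trans hS, ?_⟩, ?_, y, Finset.mem_erase.2 ⟨hyx, hy⟩, hB⟩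
      · have := Finset.card_erase_of_mem hx
        simp only at this hc ⊢
        omega
      · exact Finset.mem_sdiff.2 ⟨hS hx, fun hh => (Finset.mem_erase.1 hh).1 rfl⟩
    · rintro ⟨S, x⟩ hz ⟨S', x'⟩ hz' e
      rw [Finset.mem_coe, hT, Finset.mem_sigma, Finset.mem_filter] at hz hz'
      have e1 := congrArg Sigma.fst e
      have e2 : x = x' := congrArg Sigma.snd e
      subst e2
      have e3 : S = S' := by
        have a1 : x ∈ S := hz.2.1
        have a2 : x ∈ S' := hz'.2.1
        rw [← Finset.insert_erase a1, ← Finset.insert_erase a2]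
        exact congrArg (insert x) e1
      subst e3
      rfl
  have hUc : U.card ≤ M.card.choose r * D := by
    rw [hU, Finset.card_sigma, ← Finset.card_powersetCard, ← smul_eq_mul]
    refine Finset.sum_le_card_nsmul _ _ _ fun R hR => ?_
    rw [Finset.mem_powersetCard] at hR
    exact h R hR.1 hR.2
  have hTc : M.card.choose (r + 1) * (r + 2) ≤ 2 * T.card := by
    rw [hT, Finset.card_sigma, Finset.mul_sum, ← Finset.card_powersetCard, ← smul_eq_mul]
    refine Finset.card_nsmul_le_sum _ _ _ fun S hS => ?_
    rw [Finset.mem_powersetCard] at hS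
    have := hcon S hS.1 hS.2
    omega
  have hch := Nat.choose_succ_right_eq M.card r
  have hpos : 0 < M.card.choose (r + 1) := Nat.choose_pos hr
  have h1 : M.card.choose r * (2 * D) ≤ M.card.choose r * (M.card - r) :=
    Nat.mul_le_mul_left _ (by omega)
  rw [← hch] at h1
  nlinarith


lemma stage_two (P : Finset Pt) (K w e m : ℕ) (ℓ : ℕ → ℝ × ℝ) (M : Finset (ℕ × (Pt × Pt)))
    (Ln : ℕ × (Pt × Pt) → ℝ × ℝ) (hm : 0 < m) (he : 1 ≤ e) (hN : ¬ NonCrossingFamily P m)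
    (hS : Sys P K w e ℓ M Ln) (r : ℕ) (R : Finset (ℕ × (Pt × Pt))) (hR : R ⊆ M)
    (hr : R.card = r) :
    ((M \ R).filter (fun x => ∃ y ∈ R, ¬ (ev (Ln y) x.2.1 * ev (Ln y) x.2.2 < 0))).card ≤
      r * w + 4 * ((2 * (r + 1) + r) * (m + 2 * e)) := by
  have wmono : ∀ i j, i ≤ j → j ≤ K → (ℓ i).1 ≤ (ℓ j).1 := by
    intro i j hij hj
    rcases hij.eq_or_lt with rfl | h
    · exact le_rfl
    · exact (hS.mono i j h hj).le
  have hg : ∀ i < K, (ℓ i).1 < ((ℓ i).1 + (ℓ (i + 1)).1) / 2 ∧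
      ((ℓ i).1 + (ℓ (i + 1)).1) / 2 < (ℓ (i + 1)).1 := by
    intro i hi
    have := hS.mono i (i + 1) (by omega) (by omega)
    constructor <;> linarith
  set tags := R.image Prod.fst with htags
  have memtag : ∀ y ∈ R, y.1 ∈ tags := fun y hy => Finset.mem_image_of_mem _ hy
  have ctags : tags.card ≤ r := hr ▸ Finset.card_image_le
  have hh : ∀ i, ∃ h, i < K → i < h ∧ h ≤ K ∧ (∀ j, i < j → j < h → j ∉ tags) ∧
      (h ∈ tags ∨ h = K) := by
    intro i
    by_cases hi : i < K
    · have hex : ∃ h, i < h ∧ (h ∈ tags ∨ h = K) := ⟨K, hi, Or.inr rfl⟩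
      exact ⟨Nat.find hex, fun _ => ⟨(Nat.find_spec hex).1, Nat.find_min' hex ⟨hi, Or.inr rfl⟩,
        fun j h1 h2 h3 => Nat.find_min hex h2 ⟨h1, Or.inl h3⟩, (Nat.find_spec hex).2⟩⟩
    · exact ⟨0, fun h => absurd h hi⟩
  choose h hh using hh
  obtain ⟨Γ, hΓ⟩ : ∃ Γ : Finset ℕ, ∀ i, i ∈ Γ ↔ i < K ∧ i ∉ tags ∧ (i = 0 ∨ i - 1 ∈ tags) :=
    ⟨(Finset.range K).filter (fun i => i ∉ tags ∧ (i = 0 ∨ i - 1 ∈ tags)), fun i => by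
      rw [Finset.mem_filter, Finset.mem_range]⟩
  have cΓ : Γ.card ≤ r + 1 := by
    have : Γ ⊆ insert 0 (tags.image (· + 1)) := by
      intro i hi
      obtain ⟨-, -, h0⟩ := (hΓ i).1 hi
      rw [Finset.mem_insert, Finset.mem_image]
      by_cases hi0 : i = 0
      · exact Or.inl hi0
      · refine Or.inr ⟨i - 1, ?_, by omega⟩
        rcases h0 with h0 | h0
        · exact absurd h0 hi0
        · exact h0
    have h1 := Finset.card_le_card this
    have h2 := Finset.card_insert_le 0 (tags.image (· + 1))
    have h3 : (tags.image (· + 1)).card ≤ tags.card := Finset.card_image_le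
    omega
  have notag : ∀ i ∈ Γ, ∀ t ∈ tags, t < i ∨ h i ≤ t := by
    intro i hi t ht
    obtain ⟨h1, h2, -⟩ := (hΓ i).1 hi
    by_contra hc
    push Not at hc
    rcases hc.1.eq_or_lt with hc1 | hc1
    · exact h2 (hc1 ▸ ht)
    · exact (hh i h1).2.2.1 t hc1 hc.2 ht
  have cover : ∀ i0, i0 < K → i0 ∉ tags → ∃ i ∈ Γ, i ≤ i0 ∧ i0 < h i := by
    intro i0
    induction i0 with
    | zero => exact fun h1 h2 => ⟨0, (hΓ 0).2 ⟨h1, h2, Or.inl rfl⟩, le_rfl, (hh 0 h1).1⟩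
    | succ n ih =>
      intro h1 h2
      by_cases hn : n ∈ tags
      · exact ⟨n + 1, (hΓ _).2 ⟨h1, h2, Or.inr hn⟩, le_rfl, (hh _ h1).1⟩
      · obtain ⟨i, hi, a, b⟩ := ih (by omega) hn
        refine ⟨i, hi, by omega, ?_⟩
        by_contra hc
        have e1 : h i = n + 1 := by omega
        rcases (hh i ((hΓ i).1 hi).1).2.2.2 with h3 | h3
        · rw [e1] at h3; exact h2 h3
        · omega
  obtain ⟨ℓ', hl1, hl2⟩ : ∃ ℓ' : ℕ ⊕ (ℕ × (Pt × Pt)) → ℝ × ℝ, (∀ i, ℓ' (Sum.inl i) = ℓ i) ∧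
      ∀ z, ℓ' (Sum.inr z) = if z ∈ M then Ln z else ℓ 0 :=
    ⟨Sum.elim ℓ (fun z => if z ∈ M then Ln z else ℓ 0), fun _ => rfl, fun _ => rfl⟩
  have hl3 : ∀ z ∈ R, ℓ' (Sum.inr z) = Ln z := fun z hz => by rw [hl2, if_pos (hR hz)]
  -- slope facts
  have slo : ∀ y ∈ R, ∀ i, y.1 < i → i ≤ K → (Ln y).1 < (ℓ i).1 := fun y hy i h1 h2 =>
    lt_of_lt_of_le (hS.sl y (hR hy)).2 (wmono _ _ h1 h2)
  have shi : ∀ y ∈ R, ∀ i, i ≤ y.1 → (ℓ i).1 < (Ln y).1 := fun y hy i h1 =>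
    lt_of_le_of_lt (wmono _ _ h1 (hS.tag y (hR hy)).le) (hS.sl y (hR hy)).1
  have gh : ∀ i ∈ Γ, ((ℓ i).1 + (ℓ (i + 1)).1) / 2 < (ℓ (h i)).1 := by
    intro i hi
    have hiK := ((hΓ i).1 hi).1
    exact lt_of_lt_of_le (hg i hiK).2 (wmono _ _ (hh i hiK).1 (hh i hiK).2.1)
  obtain ⟨BR, BL, hBR, hBL, cBR, cBL⟩ := zoneB P m e hm hN ℓ' (by
      rintro (i | z)
      · rw [hl1]; exact (hS.nhl i).mono he
      · rw [hl2]
        split_ifs with hz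
        · exact hS.nh z hz
        · exact (hS.nhl 0).mono he)
    (R.image Sum.inr) Γ (fun i => ((ℓ i).1 + (ℓ (i + 1)).1) / 2) (fun i => Sum.inl i)
    (fun i => Sum.inl (h i))
    (fun i hi => by
      simp only [hl1]
      exact ⟨(hg i ((hΓ i).1 hi).1).1, gh i hi⟩)
    (by
      intro L hL i hi
      obtain ⟨y, hy, rfl⟩ := Finset.mem_image.1 hL
      rw [hl3 y hy, hl1, hl1]
      rcases notag i hi y.1 (memtag y hy) with h1 | h1
      · exact Or.inl (slo y hy i h1 ((hΓ i).1 hi).1.le).le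
      · exact Or.inr (shi y hy _ h1).le)
    (by
      have aux : ∀ i ∈ Γ, ∀ j ∈ Γ, i < j → ∃ L ∈ R.image Sum.inr,
          ((ℓ i).1 + (ℓ (i + 1)).1) / 2 < (ℓ' L).1 ∧
          (ℓ' L).1 < ((ℓ j).1 + (ℓ (j + 1)).1) / 2 := by
        intro i hi j hj hij
        obtain ⟨j1, j2, j3⟩ := (hΓ j).1 hj
        have hjt : j - 1 ∈ tags := by
          rcases j3 with j3 | j3
          · omega
          · exact j3
        obtain ⟨y, hy, hyj⟩ := Finset.mem_image.1 hjt
        refine ⟨Sum.inr y, Finset.mem_image_of_mem _ hy, ?_⟩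
        rw [hl3 y hy]
        constructor
        · rcases notag i hi (j - 1) hjt with h1 | h1
          · omega
          · exact (gh i hi).trans (shi y hy _ (by omega))
        · exact (slo y hy j (by omega) j1.le).trans (hg j j1).1
      intro i hi j hj hne
      rcases Nat.lt_or_gt_of_ne hne with h1 | h1
      · obtain ⟨L, hL, hh⟩ := aux i hi j hj h1
        exact ⟨L, hL, Or.inl hh⟩
      · obtain ⟨L, hL, hh⟩ := aux j hj i hi h1
        exact ⟨L, hL, Or.inr hh⟩)
  have cim : (R.image (Sum.inr : _ → ℕ ⊕ (ℕ × (Pt × Pt)))).card ≤ r := hr ▸ Finset.card_image_le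
  have cmul : 2 * ((2 * Γ.card + (R.image (Sum.inr : _ → ℕ ⊕ (ℕ × (Pt × Pt)))).card) * (m + 2 * e))
      ≤ 2 * ((2 * (r + 1) + r) * (m + 2 * e)) := by
    gcongr
  set A1 := tags.biUnion (fun t => M.filter (fun z => z.1 = t)) with hA1
  set A2 := M.filter (fun z => z.2.1 ∈ Γ.biUnion BR) with hA2
  set A3 := M.filter (fun z => z.2.2 ∈ Γ.biUnion BL) with hA3
  have c1 : A1.card ≤ r * w := by
    refine Finset.card_biUnion_le.trans ?_
    calc ∑ t ∈ tags, (M.filter (fun z => z.1 = t)).card ≤ ∑ t ∈ tags, w :=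
          Finset.sum_le_sum fun t _ => hS.fib t
      _ = tags.card * w := by rw [Finset.sum_const, smul_eq_mul]
      _ ≤ r * w := Nat.mul_le_mul_right _ ctags
  have c2 : A2.card ≤ 2 * ((2 * (r + 1) + r) * (m + 2 * e)) := by
    refine le_trans ?_ (Finset.card_biUnion_le.trans (cBR.trans cmul))
    refine Finset.card_le_card_of_injOn (fun z => z.2.1) ?_ ?_
    · intro z hz
      exact (Finset.mem_filter.1 (Finset.mem_coe.1 hz)).2
    · intro z hz z' hz' e
      exact hS.inj1 z (Finset.mem_filter.1 (Finset.mem_coe.1 hz)).1 z'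
        (Finset.mem_filter.1 (Finset.mem_coe.1 hz')).1 e
  have c3 : A3.card ≤ 2 * ((2 * (r + 1) + r) * (m + 2 * e)) := by
    refine le_trans ?_ (Finset.card_biUnion_le.trans (cBL.trans cmul))
    refine Finset.card_le_card_of_injOn (fun z => z.2.2) ?_ ?_
    · intro z hz
      exact (Finset.mem_filter.1 (Finset.mem_coe.1 hz)).2
    · intro z hz z' hz' e
      exact hS.inj2 z (Finset.mem_filter.1 (Finset.mem_coe.1 hz)).1 z'
        (Finset.mem_filter.1 (Finset.mem_coe.1 hz')).1 e
  have hsub : (M \ R).filter (fun x => ∃ y ∈ R, ¬ (ev (Ln y) x.2.1 * ev (Ln y) x.2.2 < 0)) ⊆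
      A1 ∪ (A2 ∪ A3) := by
    intro x hx
    obtain ⟨hx1, y, hy, hB⟩ := Finset.mem_filter.1 hx
    have hxM := (Finset.mem_sdiff.1 hx1).1
    rw [Finset.mem_union, Finset.mem_union]
    by_cases hxt : x.1 ∈ tags
    · exact Or.inl (Finset.mem_biUnion.2 ⟨x.1, hxt, Finset.mem_filter.2 ⟨hxM, rfl⟩⟩)
    right
    obtain ⟨i, hi, hi1, hi2⟩ := cover x.1 (hS.tag x hxM) hxt
    have hiK := ((hΓ i).1 hi).1
    have f1 := hS.pl x hxM i hi1
    have f2 := hS.pu x hxM (h i) hi2 (hh i hiK).2.1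
    have gR := hBR i x.2.1 (hS.pmem x hxM) (by rw [hl1]; exact f1.1.le) (by rw [hl1]; exact f2.1.le)
    have gL := hBL i x.2.2 (hS.qmem x hxM) (by rw [hl1]; exact f1.2.le) (by rw [hl1]; exact f2.2.le)
    have toR : x.2.1 ∈ BR i → x ∈ A2 ∨ x ∈ A3 := fun hb =>
      Or.inl (Finset.mem_filter.2 ⟨hxM, Finset.mem_biUnion.2 ⟨i, hi, hb⟩⟩)
    have toL : x.2.2 ∈ BL i → x ∈ A2 ∨ x ∈ A3 := fun hb =>
      Or.inr (Finset.mem_filter.2 ⟨hxM, Finset.mem_biUnion.2 ⟨i, hi, hb⟩⟩)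
    have hyi : Sum.inr y ∈ R.image (Sum.inr : _ → ℕ ⊕ (ℕ × (Pt × Pt))) :=
      Finset.mem_image_of_mem _ hy
    rcases notag i hi y.1 (memtag y hy) with h1 | h1
    · have hs : (Ln y).1 < ((ℓ i).1 + (ℓ (i + 1)).1) / 2 :=
        (slo y hy i h1 hiK.le).trans (hg i hiK).1
      by_cases hp : ev (Ln y) x.2.1 ≤ 0
      · exact toR (gR (Or.inl ⟨_, hyi, by rw [hl3 y hy]; exact ⟨hs, hp⟩⟩))
      · refine toL (gL (Or.inl ⟨_, hyi, ?_⟩))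
        rw [hl3 y hy]
        refine ⟨hs, ?_⟩
        by_contra hq
        push Not at hp hq
        exact hB (mul_neg_of_pos_of_neg hp hq)
    · have hs : ((ℓ i).1 + (ℓ (i + 1)).1) / 2 < (Ln y).1 := (gh i hi).trans (shi y hy _ h1)
      by_cases hp : 0 ≤ ev (Ln y) x.2.1
      · exact toR (gR (Or.inr ⟨_, hyi, by rw [hl3 y hy]; exact ⟨hs, hp⟩⟩))
      · refine toL (gL (Or.inr ⟨_, hyi, ?_⟩))
        rw [hl3 y hy]
        refine ⟨hs, ?_⟩
        by_contra hq
        push Not at hp hq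
        exact hB (mul_neg_of_neg_of_pos hp hq)
  have k1 := Finset.card_le_card hsub
  have k2 := Finset.card_union_le A1 (A2 ∪ A3)
  have k3 := Finset.card_union_le A2 A3
  omega

/-- There is a constant `C > 0` such that for all positive integers `m` and `k`,
every finite planar point set `P` in general position with `|P| ≥ C·k·m` contains either a
crossing family of size `k` or a non-crossing family of size `m`. -/
theorem stmt1 :
    ∃ C : ℝ, 0 < C ∧ ∀ m k : ℕ, 0 < m → 0 < k →
      ∀ P : Finset Pt, GenPos P → C * (k : ℝ) * (m : ℝ) ≤ (P.card : ℝ) →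
        CrossingFamily P k ∨ NonCrossingFamily P m := by
  refine ⟨1000000, by norm_num, ?_⟩
  intro m k hm hk P hP hcard
  by_cases hN : NonCrossingFamily P m
  · exact Or.inr hN
  left
  have hc : 1000000 * k * m ≤ P.card := by exact_mod_cast hcard
  have hkm : m ≤ k * m := Nat.le_mul_of_pos_left _ hk
  have hkm' : k ≤ k * m := Nat.le_mul_of_pos_right _ hm
  have hc' : 1000000 * (k * m) ≤ P.card := by rw [← mul_assoc]; exact hc
  obtain ⟨K, ℓ, hmono, hz, hNH, hWp, hWm, hK⟩ := base_lines P hP (100 * m) (by omega)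
  obtain ⟨M, Ln, hS, hMc⟩ := exists_sys P m (100 * m) K hm hP hN (by omega) ℓ hmono hz hNH hWp hWm
  have hK2 : 5000 * k ≤ K + 1 := by
    have h1 : 500000 * (k * m) ≤ (K + 1) * (100 * m) := by omega
    have h2 : (5000 * k) * (100 * m) ≤ (K + 1) * (100 * m) := by linarith
    exact Nat.le_of_mul_le_mul_right h2 (by omega)
  have hK3 : 4999 * k ≤ K := by omega
  have hKm : 4999 * (k * m) ≤ K * m := by
    rw [← mul_assoc]; exact Nat.mul_le_mul_right _ hK3
  have hMbig : 50 * (K * m) ≤ M.card := by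
    have h1 : (3 * K + 1) * (m + 2) ≤ (4 * K) * (3 * m) :=
      Nat.mul_le_mul (by omega) (by omega)
    have h2 : (4 * K) * (3 * m) = 12 * (K * m) := by ring
    have h3 : K * (100 * m) = 100 * (K * m) := by ring
    have h4 : 2 * K * m = 2 * (K * m) := by ring
    omega
  have hst := stage_two P K (100 * m) (100 * m + m + 1) m ℓ M Ln hm (by omega) hN hS (2 * k - 1)
  have hD : (2 * k - 1) * (100 * m) + 4 * ((2 * (2 * k - 1 + 1) + (2 * k - 1)) *
      (m + 2 * (100 * m + m + 1))) ≤ 5200 * (k * m) := by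
    have h1 : (2 * k - 1) * (100 * m) ≤ (2 * k) * (100 * m) := Nat.mul_le_mul_right _ (by omega)
    have h2 : (2 * (2 * k - 1 + 1) + (2 * k - 1)) * (m + 2 * (100 * m + m + 1)) ≤
      (6 * k) * (205 * m) := Nat.mul_le_mul (by omega) (by omega)
    have h3 : (2 * k) * (100 * m) = 200 * (k * m) := by ring
    have h4 : (6 * k) * (205 * m) = 1230 * (k * m) := by ring
    omega
  obtain ⟨S, hSM, hSc, hSb⟩ := averaging M
    (fun y x => ¬ (ev (Ln y) x.2.1 * ev (Ln y) x.2.2 < 0)) (2 * k - 1) (5200 * (k * m))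
    (fun R hR hr => by
      have h1 := (hst R hR hr).trans hD
      refine le_trans (le_of_eq ?_) h1
      congr!) (by omega) (by omega)
  set Bad := S.filter (fun x => ∃ y ∈ S, y ≠ x ∧ ¬ (ev (Ln y) x.2.1 * ev (Ln y) x.2.2 < 0)) with hBad
  have hgood : k ≤ (S \ Bad).card := by
    have hSb' : 2 * Bad.card ≤ 2 * k - 1 + 1 := by
      rw [hBad]
      convert hSb
    have hsum : (S \ Bad).card + Bad.card = S.card := Finset.card_sdiff_add_card_eq_card (Finset.filter_subset _ _ : Bad ⊆ S)
    omega
  obtain ⟨T, hT, hTc⟩ := Finset.exists_subset_card_eq hgood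
  have hTM : ∀ z ∈ T, z ∈ M := fun z hz => hSM (Finset.mem_sdiff.1 (hT hz)).1
  have hsep : ∀ x ∈ T, ∀ y ∈ T, y ≠ x → ev (Ln y) x.2.1 * ev (Ln y) x.2.2 < 0 := by
    intro x hx y hy hne
    obtain ⟨hxS, hxB⟩ := Finset.mem_sdiff.1 (hT hx)
    by_contra hcon
    exact hxB (Finset.mem_filter.2 ⟨hxS, y, (Finset.mem_sdiff.1 (hT hy)).1, hne, hcon⟩)
  refine ⟨T.image Prod.snd, ?_, ?_, ?_⟩
  · rw [Finset.card_image_of_injOn, hTc]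
    intro z hz z' hz' e
    exact hS.inj1 z (hTM z hz) z' (hTM z' hz') (congrArg Prod.fst e)
  · intro s hs
    obtain ⟨z, hz, rfl⟩ := Finset.mem_image.1 hs
    exact ⟨hS.pmem z (hTM z hz), hS.qmem z (hTM z hz)⟩
  · intro s hs t ht hne
    obtain ⟨z, hz, rfl⟩ := Finset.mem_image.1 hs
    obtain ⟨z', hz', rfl⟩ := Finset.mem_image.1 ht
    have hzz : z ≠ z' := fun e => hne (by rw [e])
    exact seg_cross (Ln z) (Ln z') z.2.1 z.2.2 z'.2.1 z'.2.2 (hS.on z (hTM z hz)).1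
      (hS.on z (hTM z hz)).2 (hS.on z' (hTM z' hz')).1 (hS.on z' (hTM z' hz')).2
      (hsep z hz z' hz' hzz.symm) (hsep z' hz' z hz hzz)
end
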